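/- arXiv:1908.09661 — 6 statements merged into one kernel-verified Lean document; each statement's English description precedes it below -/
import Mathlib

section
/- Let (Z,b) be a non-degenerate alternating bilinear K[u]-module. The following are equivalent: (i) (Z,b) is isomorphic as a bilinear K[u]-module to the paired module associated with some finite-dimensional K-vector space with unipotent automorphism; (ii) Z = W ⊕ W' for u-invariant subspaces W and W' that are both totally singular with respect to b; (iii) ε_{Z,b}(d) = 0 for all d ≥ 1. Moreover, if Z = W ⊕ W' as in (ii), then for every d ≥ 1 the Jordan block multiplicity of size d of u on Z equals twice its multiplicity on W, and (Z,b) is isomorphic to the paired module associated with W. -/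
open Module LinearMap

noncomputable section

/-- Multiplicity of a Jordan block of size `d` of a unipotent map `u`, computed from
`f = u - 1` as `rank f^(d-1) - 2 rank f^d + rank f^(d+1)`. -/
def jordanMult (K : Type*) [Field K] {V : Type*} [AddCommGroup V] [Module K V]
    (f : V →ₗ[K] V) (d : ℕ) : ℕ :=
  Module.finrank K (LinearMap.range (f ^ (d - 1))) +
    Module.finrank K (LinearMap.range (f ^ (d + 1))) -
    2 * Module.finrank K (LinearMap.range (f ^ d))

open Classical in
/-- The invariant ε_{V,b}(d) of Hesselink/Spaltenstein, computed from `f = u - 1`. -/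
def eps (K : Type*) [Field K] {V : Type*} [AddCommGroup V] [Module K V]
    (f : V →ₗ[K] V) (b : V →ₗ[K] V →ₗ[K] K) (d : ℕ) : ℕ :=
  if ∃ v : V, (f ^ d) v = 0 ∧ b ((f ^ (d - 1)) v) v ≠ 0 then 1 else 0

/-- A linear endomorphism is unipotent if `(f - 1)^N = 0` for some `N`. -/
def IsUnipotent (K : Type*) [Field K] {V : Type*} [AddCommGroup V] [Module K V]
    (f : V →ₗ[K] V) : Prop :=
  ∃ N : ℕ, (f - 1) ^ N = 0

/-- The standard single unipotent Jordan block of size `m` over `K`. -/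
def jordanBlockMap (K : Type*) [Field K] (m : ℕ) : (Fin m → K) →ₗ[K] (Fin m → K) :=
  Matrix.toLin' (1 + Matrix.of fun i j : Fin m => if (i : ℕ) + 1 = (j : ℕ) then 1 else 0)

end

noncomputable section

/-- `(Z, u, b)` is isomorphic, as a bilinear module, to the paired module `(M ⊕ M*, a)`
associated with `(M, w)`, where `a(v+f, v'+f') = f(v') + f'(v)` and the automorphism acts by
`w` on `M` and by `f ↦ f ∘ w⁻¹` on `M*`. -/
def IsPairedIso {K : Type*} [Field K] {Z M : Type*} [AddCommGroup Z] [Module K Z]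
    [AddCommGroup M] [Module K M] (u : Z ≃ₗ[K] Z) (b : Z →ₗ[K] Z →ₗ[K] K)
    (w : M ≃ₗ[K] M) : Prop :=
  ∃ φ : Z ≃ₗ[K] M × Module.Dual K M,
    (∀ z, φ (u z) = (w (φ z).1, w.symm.dualMap (φ z).2)) ∧
    (∀ z z', b z z' = (φ z).2 (φ z').1 + (φ z').2 (φ z).1)

end


section PairedHelpers

theorem pm_rec_zero {K : Type*} [Field K] (B : ℕ → ℕ → K)
    (h : ∀ i j, B i (j+1) = B (i+1) j + B (i+1) (j+1)) (N : ℕ)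
    (hN : ∀ i j, N ≤ i → B i j = 0) (n : ℕ) (h0 : ∀ i, n ≤ i → B i 0 = 0) :
    ∀ j i, n ≤ i + j → B i j = 0 := by
  intro j
  induction j with
  | zero => intro i hi; exact h0 i (by simpa using hi)
  | succ j ih =>
    have key : ∀ m i, N - i ≤ m → n ≤ i + (j+1) → B i (j+1) = 0 := by
      intro m
      induction m with
      | zero => intro i hi _; exact hN _ _ (by omega)
      | succ m ihm =>
        intro i hi hn
        rw [h, ih (i+1) (by omega)]
        by_cases hNi : N ≤ i
        · rw [hN (i+1) (j+1) (by omega), add_zero]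
        · rw [ihm (i+1) (by omega) (by omega), add_zero]
    exact fun i hi => key _ i le_rfl hi

theorem pm_rec_one {K : Type*} [Field K] (B : ℕ → ℕ → K)
    (h : ∀ i j, B i (j+1) = B (i+1) j + B (i+1) (j+1)) (n : ℕ)
    (h0 : ∀ j i, n + 1 ≤ i + j → B i j = 0) :
    ∀ j i, i + j = n → B i j = B n 0 := by
  intro j
  induction j with
  | zero => intro i hi; rw [show i = n by simpa using hi]
  | succ j ih =>
    intro i hi
    rw [h, ih (i+1) (by omega), h0 (j+1) (i+1) (by omega), add_zero]

theorem pm_rec_two {K : Type*} [Field K] (B : ℕ → ℕ → K)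
    (h : ∀ i j, B i (j+1) = B (i+1) j + B (i+1) (j+1)) (n : ℕ)
    (h0 : ∀ j i, n + 2 ≤ i + j → B i j = 0) :
    ∀ j i, i + j = n → B i j = B n 0 + j * B (n+1) 0 := by
  intro j
  induction j with
  | zero => intro i hi; rw [show i = n by simpa using hi]; simp
  | succ j ih =>
    intro i hi
    rw [h, ih (i+1) (by omega), pm_rec_one B h (n+1) h0 (j+1) (i+1) (by omega)]
    push_cast; ring

variable {K : Type*} [Field K] [CharP K 2] {Z : Type*} [AddCommGroup Z] [Module K Z]

theorem pm_brec (f : Z →ₗ[K] Z) (b : Z →ₗ[K] Z →ₗ[K] K)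
    (hf : ∀ x y, b x (f y) = b (f x) y + b (f x) (f y)) (v w : Z) (i j : ℕ) :
    b ((f^i) v) ((f^(j+1)) w) = b ((f^(i+1)) v) ((f^j) w) + b ((f^(i+1)) v) ((f^(j+1)) w) := by
  have e : ∀ (k : ℕ) (x : Z), (f^(k+1)) x = f ((f^k) x) := by
    intro k x; rw [pow_succ']; rfl
  rw [e, e, hf]

theorem pm_pow_zero (f : Z →ₗ[K] Z) (d : ℕ) (v : Z) (h : (f^d) v = 0) (i : ℕ) (hi : d ≤ i) :
    (f^i) v = 0 := by
  obtain ⟨k, rfl⟩ := Nat.exists_eq_add_of_le hi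
  rw [add_comm, pow_add, Module.End.mul_apply, h, map_zero]

theorem pm_B0 (f : Z →ₗ[K] Z) (b : Z →ₗ[K] Z →ₗ[K] K)
    (hf : ∀ x y, b x (f y) = b (f x) y + b (f x) (f y)) (v w : Z) (d : ℕ) (hv : (f^d) v = 0) :
    ∀ j i, d ≤ i + j → b ((f^i) v) ((f^j) w) = 0 :=
  pm_rec_zero (fun i j => b ((f^i) v) ((f^j) w)) (pm_brec f b hf v w) d
    (fun i j hi => by simp [pm_pow_zero f d v hv i hi]) d
    (fun i hi => by simp [pm_pow_zero f d v hv i hi])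

theorem pm_B1 (f : Z →ₗ[K] Z) (b : Z →ₗ[K] Z →ₗ[K] K)
    (hf : ∀ x y, b x (f y) = b (f x) y + b (f x) (f y)) (v w : Z) (d : ℕ) (hv : (f^(d+1)) v = 0)
    (i j : ℕ) (hij : i + j = d) :
    b ((f^i) v) ((f^j) w) = b ((f^d) v) w :=
  pm_rec_one (fun i j => b ((f^i) v) ((f^j) w)) (pm_brec f b hf v w) d
    (pm_B0 f b hf v w (d+1) hv) j i hij

theorem pm_B2 (f : Z →ₗ[K] Z) (b : Z →ₗ[K] Z →ₗ[K] K)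
    (hf : ∀ x y, b x (f y) = b (f x) y + b (f x) (f y)) (v w : Z) (d : ℕ) (hv : (f^(d+2)) v = 0)
    (i j : ℕ) (hij : i + j = d) :
    b ((f^i) v) ((f^j) w) = b ((f^d) v) w + j * b ((f^(d+1)) v) w :=
  pm_rec_two (fun i j => b ((f^i) v) ((f^j) w)) (pm_brec f b hf v w) d
    (pm_B0 f b hf v w (d+2) hv) j i hij

theorem pm_quad [IsAlgClosed K] (γ δ ε : K) (hδ : δ ≠ 0) : ∃ c : K, ε + c * δ + c * c * γ = 0 := by
  obtain ⟨c, hc⟩ := IsAlgClosed.exists_root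
    (Polynomial.C γ * Polynomial.X ^ 2 + Polynomial.C δ * Polynomial.X + Polynomial.C ε) (by
      by_cases hγ : γ = 0
      · simp [hγ, Polynomial.degree_linear hδ]
      · rw [Polynomial.degree_quadratic hγ]; norm_num)
  refine ⟨c, ?_⟩
  simp [Polynomial.IsRoot] at hc
  linear_combination hc

theorem pm_modify [IsAlgClosed K] (f : Z →ₗ[K] Z) (b : Z →ₗ[K] Z →ₗ[K] K)
    (hf : ∀ x y, b x (f y) = b (f x) y + b (f x) (f y))
    (halt : ∀ x, b x x = 0) (hsym : ∀ x y, b x y = b y x)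
    (N : Submodule K Z) (hN : ∀ x ∈ N, f x ∈ N) (d : ℕ) (hd : ∀ x ∈ N, (f^(d+1)) x = 0)
    (heps : ∀ x ∈ N, b ((f^d) x) x = 0) (v w : Z) (hv : v ∈ N) (hw : w ∈ N)
    (hvw : b ((f^d) v) w ≠ 0) :
    ∃ v' ∈ N, (∀ i, b ((f^i) v') v' = 0) ∧ b ((f^d) v') w ≠ 0 := by
  have h2 : (2 : K) = 0 := by exact_mod_cast CharP.cast_eq_zero K 2
  have hNp : ∀ (i : ℕ), ∀ x ∈ N, (f^i) x ∈ N := by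
    intro i
    induction i with
    | zero => intro x hx; simpa using hx
    | succ i ih => intro x hx; rw [pow_succ', Module.End.mul_apply]; exact hN _ (ih x hx)
  have main : ∀ m k, k + m = d → ∃ v' ∈ N, (∀ i, k ≤ i → b ((f^i) v') v' = 0) ∧
      b ((f^d) v') w ≠ 0 := by
    intro m
    induction m with
    | zero =>
      intro k hk
      refine ⟨v, hv, ?_, hvw⟩
      intro i hi
      rcases Nat.eq_or_lt_of_le hi with h | h
      · rw [← h, show k = d by omega]; exact heps v hv
      · rw [pm_pow_zero f (d+1) v (hd v hv) i (by omega)]; simp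
    | succ m ih =>
      intro k hk
      obtain ⟨x, hx, hx0, hxw⟩ := ih (k+1) (by omega)
      rcases Nat.even_or_odd k with he | ho
      · refine ⟨x, hx, ?_, hxw⟩
        intro i hi
        rcases Nat.eq_or_lt_of_le hi with h | h
        swap
        · exact hx0 i h
        subst h
        obtain ⟨l, hl⟩ := he
        have hB0 := pm_rec_zero (fun i j => b ((f^i) x) ((f^j) x)) (pm_brec f b hf x x) (d+1)
          (fun i j hi => by simp [pm_pow_zero f (d+1) x (hd x hx) i hi]) (k+1)
          (fun i hi => by simpa using hx0 i hi)
        have := pm_rec_one (fun i j => b ((f^i) x) ((f^j) x)) (pm_brec f b hf x x) k hB0 l l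
          (by omega)
        simp only [halt, pow_zero, Module.End.one_apply] at this
        exact this.symm
      · obtain ⟨n, rfl⟩ : ∃ n, d = n + 1 := ⟨d - 1, by omega⟩
        have hxw1 : b ((f^(n+1)) w) x = b ((f^(n+1)) x) w := by
          rw [hsym, ← pm_B1 f b hf x w (n+1) (hd x hx) 0 (n+1) (by omega)]; simp
        have hδ : b ((f^k) x) ((f^m) w) + b ((f^n) w) x = b ((f^(n+1)) x) w := by
          have e1 := pm_B2 f b hf x w n (hd x hx) k m (by omega)
          have e2 := pm_B2 f b hf x w n (hd x hx) 0 n (by omega)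
          simp only [pow_zero, Module.End.one_apply] at e2
          rw [hsym _ x, e1, e2]
          obtain ⟨l, hl⟩ := ho
          rw [show n = m + (2*l+1) by omega]
          push_cast
          linear_combination (b ((f^(m + (2*l+1))) x) w +
            (m + l) * b ((f^(m + (2*l+1)+1)) x) w) * h2
        obtain ⟨c, hc⟩ := pm_quad (b ((f^n) w) ((f^m) w)) (b ((f^(n+1)) x) w)
          (b ((f^k) x) x) hxw
        have hexp : ∀ i, b ((f^i) (x + c • (f^m) w)) (x + c • (f^m) w) =
            b ((f^i) x) x + c * (b ((f^i) x) ((f^m) w) + b ((f^(i+m)) w) x)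
              + c * c * b ((f^(i+m)) w) ((f^m) w) := by
          intro i
          rw [pow_add, Module.End.mul_apply]
          simp only [map_add, map_smul, LinearMap.add_apply, LinearMap.smul_apply, smul_eq_mul]
          ring
        refine ⟨x + c • (f^m) w, N.add_mem hx (N.smul_mem _ (hNp _ _ hw)), ?_, ?_⟩
        · intro i hi
          rw [hexp]
          rcases Nat.eq_or_lt_of_le hi with h | h
          · subst h
            rw [show k + m = n by omega, hδ, hc]
          rw [hx0 i h]
          rcases Nat.eq_or_lt_of_le (show n + 1 ≤ i + m by omega) with h' | h'
          · rw [← h', pm_B1 f b hf x w (n+1) (hd x hx) i m h'.symm, hxw1]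
            have : b ((f^(n+1)) w) ((f^m) w) = 0 := by
              rcases Nat.eq_zero_or_pos m with hm | hm
              · subst hm; simpa using heps w hw
              · exact pm_B0 f b hf w w (n+2) (hd w hw) m (n+1) (by omega)
            rw [this]
            linear_combination (c * b ((f^(n+1)) x) w) * h2
          · rw [pm_B0 f b hf x w (n+2) (hd x hx) m i (by omega),
              pm_pow_zero f (n+2) w (hd w hw) (i+m) (by omega)]
            simp
        · have : b ((f^(n+1)) (x + c • (f^m) w)) w = b ((f^(n+1)) x) w := by
            have h3 : b ((f^(n+1)) ((f^m) w)) w = 0 := by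
              rw [← Module.End.mul_apply, ← pow_add]
              rcases Nat.eq_zero_or_pos m with hm | hm
              · subst hm; simpa using heps w hw
              · rw [pm_pow_zero f (n+2) w (hd w hw) (n+1+m) (by omega)]; simp
            simp [h3]
          rw [this]; exact hxw
  obtain ⟨v', h1, h3, h4⟩ := main d 0 (by omega)
  exact ⟨v', h1, fun i => h3 i (Nat.zero_le _), h4⟩

def pmCyc (f : Z →ₗ[K] Z) (d : ℕ) (v : Z) : Submodule K Z :=
  Submodule.span K (Set.range fun i : Fin (d+1) => (f^(i:ℕ)) v)

theorem pm_cyc_mem (f : Z →ₗ[K] Z) (d : ℕ) (v : Z) (hv : (f^(d+1)) v = 0) (i : ℕ) :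
    (f^i) v ∈ pmCyc f d v := by
  by_cases hi : i < d + 1
  · exact Submodule.subset_span ⟨⟨i, hi⟩, rfl⟩
  · rw [pm_pow_zero f (d+1) v hv i (by omega)]; exact Submodule.zero_mem _

theorem pm_cyc_inv (f : Z →ₗ[K] Z) (d : ℕ) (v : Z) (hv : (f^(d+1)) v = 0) :
    ∀ x ∈ pmCyc f d v, f x ∈ pmCyc f d v := by
  intro x hx
  induction hx using Submodule.span_induction with
  | mem x hx =>
    obtain ⟨i, rfl⟩ := hx
    have := pm_cyc_mem f d v hv (i+1)
    rwa [pow_succ', Module.End.mul_apply] at this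
  | zero => simp
  | add x y _ _ h1 h2 => rw [map_add]; exact Submodule.add_mem _ h1 h2
  | smul a x _ h => rw [map_smul]; exact Submodule.smul_mem _ _ h

theorem pm_cyc_sing (f : Z →ₗ[K] Z) (b : Z →ₗ[K] Z →ₗ[K] K)
    (hf : ∀ x y, b x (f y) = b (f x) y + b (f x) (f y)) (d : ℕ) (v : Z) (hv : (f^(d+1)) v = 0)
    (h : ∀ i, b ((f^i) v) v = 0) :
    ∀ x ∈ pmCyc f d v, ∀ y ∈ pmCyc f d v, b x y = 0 := by
  have h0 := pm_rec_zero (fun i j => b ((f^i) v) ((f^j) v)) (pm_brec f b hf v v) (d+1)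
          (fun i j hi => by simp [pm_pow_zero f (d+1) v hv i hi]) 0
          (fun i hi => by simpa using h i)
  intro x hx y hy
  induction hx, hy using Submodule.span_induction₂ with
  | mem_mem x y hx hy =>
    obtain ⟨i, rfl⟩ := hx
    obtain ⟨j, rfl⟩ := hy
    exact h0 _ _ (Nat.zero_le _)
  | zero_left => simp
  | zero_right => simp
  | add_left x y z _ _ _ h1 h2 => simp [h1, h2]
  | add_right x y z _ _ _ h1 h2 => simp [h1, h2]
  | smul_left a x y _ _ h => simp [h]
  | smul_right a x y _ _ h => simp [h]

theorem pm_cyc_nondeg (f : Z →ₗ[K] Z) (b : Z →ₗ[K] Z →ₗ[K] K)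
    (hf : ∀ x y, b x (f y) = b (f x) y + b (f x) (f y)) (d : ℕ) (v w : Z)
    (hv : (f^(d+1)) v = 0) (hw : (f^(d+1)) w = 0) (hvw : b ((f^d) v) w ≠ 0) :
    ∀ x ∈ pmCyc f d v, (∀ y ∈ pmCyc f d w, b x y = 0) → x = 0 := by
  intro x hx hxy
  obtain ⟨c, rfl⟩ := (Submodule.mem_span_range_iff_exists_fun K).1 hx
  have hc : ∀ n (hn : n < d + 1), c ⟨n, hn⟩ = 0 := by
    intro n
    induction n using Nat.strong_induction_on with
    | _ n ih =>
      intro hn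
      have h1 := hxy _ (pm_cyc_mem f d w hw (d - n))
      rw [map_sum, LinearMap.sum_apply, Finset.sum_eq_single ⟨n, hn⟩] at h1
      · rw [map_smul, LinearMap.smul_apply, smul_eq_mul,
          pm_B1 f b hf v w d hv n (d-n) (by omega)] at h1
        exact (mul_eq_zero.1 h1).resolve_right hvw
      · intro i _ hi
        rcases lt_or_ge i.1 n with h | h
        · rw [ih i.1 h i.2]; simp
        · have : i.1 ≠ n := fun h => hi (Fin.ext h)
          rw [map_smul, LinearMap.smul_apply,
            pm_B0 f b hf v w (d+1) hv (d-n) i.1 (by omega), smul_zero]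
      · simp
  exact Finset.sum_eq_zero fun i _ => by rw [hc i.1 i.2, zero_smul]

structure PmGood (f : Z →ₗ[K] Z) (b : Z →ₗ[K] Z →ₗ[K] K) (W W' : Submodule K Z) : Prop where
  inv : ∀ x ∈ W, f x ∈ W
  inv' : ∀ x ∈ W', f x ∈ W'
  sing : ∀ x ∈ W, ∀ y ∈ W, b x y = 0
  sing' : ∀ x ∈ W', ∀ y ∈ W', b x y = 0
  nd : ∀ x ∈ W, (∀ y ∈ W', b x y = 0) → x = 0
  nd' : ∀ x ∈ W', (∀ y ∈ W, b x y = 0) → x = 0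

theorem pm_extend [IsAlgClosed K] [FiniteDimensional K Z]
    (f : Z →ₗ[K] Z) (b : Z →ₗ[K] Z →ₗ[K] K)
    (hf : ∀ x y, b x (f y) = b (f x) y + b (f x) (f y))
    (halt : ∀ x, b x x = 0) (hsym : ∀ x y, b x y = b y x)
    (hnd : ∀ v, (∀ w, b v w = 0) → v = 0) (hnil : ∃ n, f^n = 0)
    (heps : ∀ d x, (f^(d+1)) x = 0 → b ((f^d) x) x = 0)
    (W W' : Submodule K Z) (hg : PmGood f b W W') (htop : W ⊔ W' ≠ ⊤) :
    ∃ W1 W1', PmGood f b W1 W1' ∧ Module.finrank K W < Module.finrank K W1 := by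
  have hrefl : LinearMap.IsRefl b := fun x y h => by rw [hsym]; exact h
  have hres : LinearMap.Nondegenerate (LinearMap.BilinForm.restrict b (W ⊔ W')) := by
    have key : ∀ x ∈ W ⊔ W', (∀ y ∈ W ⊔ W', b x y = 0) → x = 0 := by
      intro x hx h
      obtain ⟨p, hp, q, hq, rfl⟩ := Submodule.mem_sup.1 hx
      have hp0 : p = 0 := hg.nd p hp fun y hy => by
        have := h y (Submodule.mem_sup_right hy)
        simpa [hg.sing' q hq y hy] using this
      have hq0 : q = 0 := hg.nd' q hq fun y hy => by
        have := h y (Submodule.mem_sup_left hy)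
        simpa [hg.sing p hp y hy] using this
      rw [hp0, hq0, add_zero]
    constructor
    · intro x hx
      exact Subtype.ext (key x x.2 fun y hy => by simpa using hx ⟨y, hy⟩)
    · intro x hx
      exact Subtype.ext (key x x.2 fun y hy => by rw [hsym]; simpa using hx ⟨y, hy⟩)
  have hcompl := LinearMap.BilinForm.isCompl_orthogonal_of_restrict_nondegenerate
    (B := b) hrefl hres
  set N := LinearMap.BilinForm.orthogonal b (W ⊔ W') with hNdef
  have hNmem : ∀ x, x ∈ N ↔ ∀ y ∈ W ⊔ W', b y x = 0 := fun x => Iff.rfl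
  have hSinv : ∀ x ∈ W ⊔ W', f x ∈ W ⊔ W' := by
    intro x hx
    obtain ⟨p, hp, q, hq, rfl⟩ := Submodule.mem_sup.1 hx
    rw [map_add]
    exact Submodule.add_mem_sup (hg.inv p hp) (hg.inv' q hq)
  obtain ⟨n, hn⟩ := hnil
  have hNinv : ∀ x ∈ N, f x ∈ N := by
    intro x hx
    rw [hNmem]
    have key : ∀ m y, y ∈ W ⊔ W' → (f^m) y = 0 → b y (f x) = 0 := by
      intro m
      induction m with
      | zero => intro y _ h; simp at h; simp [h]
      | succ m ih =>
        intro y hy h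
        rw [hf, (hNmem x).1 hx _ (hSinv y hy), ih (f y) (hSinv y hy), add_zero]
        rw [← Module.End.mul_apply, ← pow_succ]; exact h
    intro y hy
    exact key n y hy (by simp [hn])
  have hNbot : N ≠ ⊥ := by
    intro h
    rw [h] at hcompl
    exact htop (by simpa using hcompl.sup_eq_top)
  have hNnd : ∀ x ∈ N, (∀ y ∈ N, b x y = 0) → x = 0 := by
    intro x hx h
    apply hnd
    intro z
    have hz : z ∈ (W ⊔ W') ⊔ N := by rw [hcompl.sup_eq_top]; trivial
    obtain ⟨p, hp, q, hq, rfl⟩ := Submodule.mem_sup.1 hz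
    rw [map_add, h q hq, hsym, (hNmem x).1 hx p hp, add_zero]
  obtain ⟨d, hd, hd'⟩ : ∃ d, (∀ x ∈ N, (f^(d+1)) x = 0) ∧ ∃ x ∈ N, (f^d) x ≠ 0 := by
    classical
    have hex : ∃ m, ∀ x ∈ N, (f^m) x = 0 := ⟨n, by simp [hn]⟩
    have h0 : Nat.find hex ≠ 0 := by
      intro h
      have h1 := Nat.find_spec hex
      rw [h] at h1
      exact hNbot ((Submodule.eq_bot_iff _).2 (by simpa using h1))
    obtain ⟨d, hd⟩ := Nat.exists_eq_succ_of_ne_zero h0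
    refine ⟨d, ?_, ?_⟩
    · have := Nat.find_spec hex
      rwa [hd] at this
    · have := Nat.find_min hex (m := d) (by omega)
      push Not at this
      exact this
  obtain ⟨v0, hv0, hv0'⟩ := hd'
  have hNp : ∀ (i : ℕ), ∀ x ∈ N, (f^i) x ∈ N := by
    intro i
    induction i with
    | zero => intro x hx; simpa using hx
    | succ i ih => intro x hx; rw [pow_succ', Module.End.mul_apply]; exact hNinv _ (ih x hx)
  obtain ⟨w0, hw0, hvw0⟩ : ∃ w0 ∈ N, b ((f^d) v0) w0 ≠ 0 := by
    by_contra h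
    push Not at h
    exact hv0' (hNnd _ (hNp d v0 hv0) h)
  have heN : ∀ x ∈ N, b ((f^d) x) x = 0 := fun x hx => heps d x (hd x hx)
  have hswap : ∀ x y, x ∈ N → b ((f^d) y) x = b ((f^d) x) y := by
    intro x y hx
    rw [hsym, ← pm_B1 f b hf x y d (hd x hx) 0 d (by omega)]; simp
  obtain ⟨v, hv, hvs, hvw⟩ := pm_modify f b hf halt hsym N hNinv d hd heN v0 w0 hv0 hw0 hvw0
  obtain ⟨w, hw, hws, hwv⟩ := pm_modify f b hf halt hsym N hNinv d hd heN w0 v hw0 hv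
    (by rw [hswap v w0 hv]; exact hvw)
  have hvw' : b ((f^d) v) w ≠ 0 := by rw [hswap w v hw]; exact hwv
  have hcN : ∀ x ∈ N, pmCyc f d x ≤ N := by
    intro x hx
    rw [pmCyc, Submodule.span_le]
    rintro _ ⟨i, rfl⟩
    exact hNp _ _ hx
  have hvN := hcN v hv
  have hwN := hcN w hw
  have oL : ∀ x ∈ W, ∀ y ∈ N, b x y = 0 := fun x hx y hy =>
    (hNmem y).1 hy x (Submodule.mem_sup_left hx)
  have oL' : ∀ x ∈ W', ∀ y ∈ N, b x y = 0 := fun x hx y hy =>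
    (hNmem y).1 hy x (Submodule.mem_sup_right hx)
  have oR : ∀ x ∈ N, ∀ y ∈ W, b x y = 0 := fun x hx y hy => by rw [hsym]; exact oL y hy x hx
  have oR' : ∀ x ∈ N, ∀ y ∈ W', b x y = 0 := fun x hx y hy => by rw [hsym]; exact oL' y hy x hx
  refine ⟨W ⊔ pmCyc f d v, W' ⊔ pmCyc f d w, ⟨?_, ?_, ?_, ?_, ?_, ?_⟩, ?_⟩
  · intro x hx
    obtain ⟨p, hp, q, hq, rfl⟩ := Submodule.mem_sup.1 hx
    rw [map_add]
    exact Submodule.add_mem_sup (hg.inv p hp) (pm_cyc_inv f d v (hd v hv) q hq)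
  · intro x hx
    obtain ⟨p, hp, q, hq, rfl⟩ := Submodule.mem_sup.1 hx
    rw [map_add]
    exact Submodule.add_mem_sup (hg.inv' p hp) (pm_cyc_inv f d w (hd w hw) q hq)
  · intro x hx y hy
    obtain ⟨p, hp, q, hq, rfl⟩ := Submodule.mem_sup.1 hx
    obtain ⟨p', hp', q', hq', rfl⟩ := Submodule.mem_sup.1 hy
    simp [hg.sing p hp p' hp', oL p hp q' (hvN hq'), oR q (hvN hq) p' hp',
      pm_cyc_sing f b hf d v (hd v hv) hvs q hq q' hq']
  · intro x hx y hy
    obtain ⟨p, hp, q, hq, rfl⟩ := Submodule.mem_sup.1 hx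
    obtain ⟨p', hp', q', hq', rfl⟩ := Submodule.mem_sup.1 hy
    simp [hg.sing' p hp p' hp', oL' p hp q' (hwN hq'), oR' q (hwN hq) p' hp',
      pm_cyc_sing f b hf d w (hd w hw) hws q hq q' hq']
  · intro x hx h
    obtain ⟨p, hp, q, hq, rfl⟩ := Submodule.mem_sup.1 hx
    have hp0 : p = 0 := hg.nd p hp fun y hy => by
      have := h y (Submodule.mem_sup_left hy)
      simpa [oR' q (hvN hq) y hy] using this
    have hq0 : q = 0 := pm_cyc_nondeg f b hf d v w (hd v hv) (hd w hw) hvw' q hq fun y hy => by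
      have := h y (Submodule.mem_sup_right hy)
      simpa [oL p hp y (hwN hy)] using this
    rw [hp0, hq0, add_zero]
  · intro x hx h
    obtain ⟨p, hp, q, hq, rfl⟩ := Submodule.mem_sup.1 hx
    have hp0 : p = 0 := hg.nd' p hp fun y hy => by
      have := h y (Submodule.mem_sup_left hy)
      simpa [oR q (hwN hq) y hy] using this
    have hq0 : q = 0 := pm_cyc_nondeg f b hf d w v (hd w hw) (hd v hv) hwv q hq fun y hy => by
      have := h y (Submodule.mem_sup_right hy)
      simpa [oL' p hp y (hvN hy)] using this
    rw [hp0, hq0, add_zero]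
  · apply Submodule.finrank_lt_finrank_of_lt
    refine lt_of_le_of_ne le_sup_left fun h => ?_
    have hvc : v ∈ pmCyc f d v := by simpa using pm_cyc_mem f d v (hd v hv) 0
    have hvW : v ∈ W := by rw [h]; exact Submodule.mem_sup_right hvc
    have : v = 0 := by
      have h1 : v ∈ (W ⊔ W') ⊓ N := ⟨Submodule.mem_sup_left hvW, hv⟩
      rw [hcompl.inf_eq_bot] at h1
      simpa using h1
    rw [this] at hvw
    simp at hvw

theorem pm_exists [IsAlgClosed K] [FiniteDimensional K Z]
    (f : Z →ₗ[K] Z) (b : Z →ₗ[K] Z →ₗ[K] K)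
    (hf : ∀ x y, b x (f y) = b (f x) y + b (f x) (f y))
    (halt : ∀ x, b x x = 0) (hsym : ∀ x y, b x y = b y x)
    (hnd : ∀ v, (∀ w, b v w = 0) → v = 0) (hnil : ∃ n, f^n = 0)
    (heps : ∀ d x, (f^(d+1)) x = 0 → b ((f^d) x) x = 0) :
    ∃ W W', PmGood f b W W' ∧ IsCompl W W' := by
  have key : ∀ m (W W' : Submodule K Z), PmGood f b W W' →
      Module.finrank K Z - Module.finrank K W ≤ m → ∃ W W', PmGood f b W W' ∧ W ⊔ W' = ⊤ := by
    intro m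
    induction m with
    | zero =>
      intro W W' hg h
      by_contra hc
      obtain ⟨W1, W1', _, hlt⟩ := pm_extend f b hf halt hsym hnd hnil heps W W' hg
        (fun h' => hc ⟨W, W', hg, h'⟩)
      have := Submodule.finrank_le W1
      omega
    | succ m ih =>
      intro W W' hg h
      by_contra hc
      obtain ⟨W1, W1', hg1, hlt⟩ := pm_extend f b hf halt hsym hnd hnil heps W W' hg
        (fun h' => hc ⟨W, W', hg, h'⟩)
      exact hc (ih W1 W1' hg1 (by omega))
  obtain ⟨W, W', hg, ht⟩ := key _ ⊥ ⊥ (by constructor <;> simp) le_rfl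
  refine ⟨W, W', hg, ?_, codisjoint_iff.2 ht⟩
  rw [Submodule.disjoint_def]
  intro x hx hx'
  exact hg.nd x hx (hg.sing' x hx')

def pmProdEquiv {M M' : Type*} [AddCommGroup M] [Module K M] [AddCommGroup M'] [Module K M']
    (p : Submodule K M) (q : Submodule K M') : p.prod q ≃ₗ[K] p × q where
  toFun x := (⟨x.1.1, x.2.1⟩, ⟨x.1.2, x.2.2⟩)
  invFun x := ⟨(x.1.1, x.2.1), ⟨x.1.2, x.2.2⟩⟩
  map_add' _ _ := rfl
  map_smul' _ _ := rfl
  left_inv _ := rfl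
  right_inv _ := rfl

theorem pm_finrank_prod {M M' : Type*} [AddCommGroup M] [Module K M] [AddCommGroup M'] [Module K M']
    [FiniteDimensional K M] [FiniteDimensional K M'] (p : Submodule K M) (q : Submodule K M') :
    Module.finrank K (p.prod q) = Module.finrank K p + Module.finrank K q := by
  rw [(pmProdEquiv p q).finrank_eq, Module.finrank_prod]

theorem pm_pairedIso [FiniteDimensional K Z] (u : Z ≃ₗ[K] Z) (b : Z →ₗ[K] Z →ₗ[K] K)
    (hsym : ∀ x y, b x y = b y x)
    (hnd : ∀ v, (∀ w, b v w = 0) → v = 0) (hinv : ∀ v w, b (u v) (u w) = b v w)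
    (W W' : Submodule K Z) (hc : IsCompl W W')
    (hu' : ∀ x ∈ W', u x ∈ W')
    (hs : ∀ x ∈ W, ∀ y ∈ W, b x y = 0) (hs' : ∀ x ∈ W', ∀ y ∈ W', b x y = 0)
    (w : W ≃ₗ[K] W) (hw : ∀ x : W, (w x : Z) = u (x : Z)) : IsPairedIso u b w := by
  have hdec : ∀ z : Z, ∃ p ∈ W, ∃ q ∈ W', p + q = z := fun z =>
    Submodule.mem_sup.1 (by rw [hc.sup_eq_top]; trivial)
  let g : W' →ₗ[K] Module.Dual K W := (b.domRestrict W').compr₂ LinearMap.id |>.flip.domRestrict W |>.flip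
  let g' : W →ₗ[K] Module.Dual K W' := (b.domRestrict W).flip.domRestrict W' |>.flip
  have hg : ∀ (x : W') (y : W), g x y = b x y := fun x y => rfl
  have hg' : ∀ (x : W) (y : W'), g' x y = b x y := fun x y => rfl
  have gi : Function.Injective g := by
    rw [← LinearMap.ker_eq_bot, LinearMap.ker_eq_bot']
    intro x hx
    apply Subtype.ext
    apply hnd
    intro z
    obtain ⟨p, hp, q, hq, rfl⟩ := hdec z
    have := hg x ⟨p, hp⟩
    rw [hx] at this
    rw [map_add, hs' x x.2 q hq, add_zero]
    exact this.symm
  have gi' : Function.Injective g' := by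
    rw [← LinearMap.ker_eq_bot, LinearMap.ker_eq_bot']
    intro x hx
    apply Subtype.ext
    apply hnd
    intro z
    obtain ⟨p, hp, q, hq, rfl⟩ := hdec z
    have := hg' x ⟨q, hq⟩
    rw [hx] at this
    rw [map_add, hs x x.2 p hp, zero_add]
    exact this.symm
  have hfr : Module.finrank K W' = Module.finrank K (Module.Dual K W) := by
    have h1 := LinearMap.finrank_le_finrank_of_injective gi
    have h2 := LinearMap.finrank_le_finrank_of_injective gi'
    rw [Subspace.dual_finrank_eq] at h1 h2 ⊢
    omega
  let e : W' ≃ₗ[K] Module.Dual K W := g.linearEquivOfInjective gi hfr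
  have he : ∀ (x : W') (y : W), e x y = b x y := fun x y => rfl
  let φ : Z ≃ₗ[K] W × Module.Dual K W :=
    (Submodule.prodEquivOfIsCompl W W' hc).symm.trans
      (LinearEquiv.prodCongr (LinearEquiv.refl K W) e)
  have hφ : ∀ (p : W) (q : W'), φ (p + q : Z) = (p, e q) := by
    intro p q
    have : (Submodule.prodEquivOfIsCompl W W' hc).symm (p + q : Z) = (p, q) := by
      rw [LinearEquiv.symm_apply_eq]; simp
    simp only [φ, LinearEquiv.trans_apply, this]
    rfl
  refine ⟨φ, ?_, ?_⟩
  · intro z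
    obtain ⟨p, hp, q, hq, rfl⟩ := hdec z
    have h1 := hφ ⟨p, hp⟩ ⟨q, hq⟩
    have h2 := hφ (w ⟨p, hp⟩) ⟨u q, hu' q hq⟩
    rw [hw] at h2
    simp only at h1 h2
    rw [map_add, h1, h2]
    refine Prod.ext rfl ?_
    ext y
    simp only [LinearEquiv.dualMap_apply, he]
    rw [← hinv q, ← hw, LinearEquiv.apply_symm_apply]
  · intro z z'
    obtain ⟨p, hp, q, hq, rfl⟩ := hdec z
    obtain ⟨p', hp', q', hq', rfl⟩ := hdec z'
    have h1 := hφ ⟨p, hp⟩ ⟨q, hq⟩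
    have h2 := hφ ⟨p', hp'⟩ ⟨q', hq'⟩
    simp only at h1 h2
    rw [h1, h2]
    simp only [he, map_add, LinearMap.add_apply]
    rw [hs p hp p' hp', hs' q hq q' hq', hsym p q']
    ring

theorem pm_rank {M : Type*} [AddCommGroup M] [Module K M] [FiniteDimensional K M]
    (u : Z ≃ₗ[K] Z) (b : Z →ₗ[K] Z →ₗ[K] K)
    (w : M ≃ₗ[K] M) (h : IsPairedIso u b w) (k : ℕ) :
    Module.finrank K (LinearMap.range (((u : Z →ₗ[K] Z) - 1)^k)) =
      2 * Module.finrank K (LinearMap.range (((w : M →ₗ[K] M) - 1)^k)) := by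
  obtain ⟨φ, hφ, -⟩ := h
  set x : M →ₗ[K] M := (w : M →ₗ[K] M) - 1
  set y : M →ₗ[K] M := (w.symm : M →ₗ[K] M) - 1
  have h1 : ∀ k z, φ ((((u : Z →ₗ[K] Z) - 1)^k) z) = ((x^k).prodMap (y^k).dualMap) (φ z) := by
    intro k
    induction k with
    | zero => intro z; rfl
    | succ k ih =>
      intro z
      rw [pow_succ, Module.End.mul_apply, ih, pow_succ, pow_succ']
      simp only [LinearMap.sub_apply, map_sub, LinearEquiv.coe_coe, hφ, Module.End.one_apply]
      refine Prod.ext ?_ ?_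
      · simp [x]
      · ext m
        simp [y]
  have h2 : LinearMap.range (((u : Z →ₗ[K] Z) - 1)^k) =
      ((LinearMap.range (x^k)).prod (LinearMap.range (y^k).dualMap)).map
        (φ.symm : (M × Module.Dual K M) →ₗ[K] Z) := by
    rw [← LinearMap.range_prodMap, ← LinearMap.range_comp]
    have : ((u : Z →ₗ[K] Z) - 1)^k =
      ((φ.symm : (M × Module.Dual K M) →ₗ[K] Z) ∘ₗ ((x^k).prodMap (y^k).dualMap)) ∘ₗ
        (φ : Z →ₗ[K] M × Module.Dual K M) := by
      ext z
      simp only [LinearMap.comp_apply, LinearEquiv.coe_coe]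
      rw [← h1, LinearEquiv.symm_apply_apply]
    rw [this, LinearMap.range_comp_of_range_eq_top _ φ.range]
  have h3 : ∀ k, ∃ e : M ≃ₗ[K] M, y^k = (e : M →ₗ[K] M) ∘ₗ x^k := by
    have hc : Commute (-(w.symm : M →ₗ[K] M)) x := by
      ext m; simp [x]
    have hy : y = -(w.symm : M →ₗ[K] M) * x := by
      ext m; simp [x, y]
    intro k
    refine ⟨(w.symm.trans (LinearEquiv.neg K))^k, ?_⟩
    rw [hy, hc.mul_pow]
    have : ∀ k, (-(w.symm : M →ₗ[K] M))^k =
        (((w.symm.trans (LinearEquiv.neg K))^k : M ≃ₗ[K] M) : M →ₗ[K] M) := by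
      intro k
      induction k with
      | zero => rfl
      | succ k ih => rw [pow_succ, pow_succ, ih]; ext m; simp
    rw [← this]
    rfl
  have h4 : Module.finrank K (LinearMap.range (y^k)) = Module.finrank K (LinearMap.range (x^k)) := by
    obtain ⟨e, he⟩ := h3 k
    rw [he, LinearMap.range_comp]
    exact LinearEquiv.finrank_map_eq e _
  rw [h2]
  rw [show ∀ p : Submodule K (M × Module.Dual K M), Module.finrank K (p.map (φ.symm : (M × Module.Dual K M) →ₗ[K] Z)) = Module.finrank K p from fun p => LinearEquiv.finrank_map_eq φ.symm p]
  rw [pm_finrank_prod,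
    LinearMap.finrank_range_dualMap_eq_finrank_range, h4]
  ring

end PairedHelpers

/-- characterization of paired modules: a non-degenerate alternating bilinear
`K[u]`-module `(Z,b)` is a paired module iff it admits a totally singular decomposition into two
`u`-invariant subspaces, iff `ε_{Z,b}` vanishes identically; and given such a decomposition
`Z = W ⊕ W'`, all Jordan multiplicities double those of `W` and `(Z,b)` is the paired module
associated with `W`. -/
theorem paired_module_characterization
    (K : Type*) [Field K] [IsAlgClosed K] [CharP K 2]
    (Z : Type*) [AddCommGroup Z] [Module K Z] [FiniteDimensional K Z]
    (u : Z ≃ₗ[K] Z) (huni : IsUnipotent K (u : Z →ₗ[K] Z))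
    (hord : ∃ k : ℕ, u ^ (2 ^ k) = 1)
    (b : Z →ₗ[K] Z →ₗ[K] K)
    (halt : ∀ v, b v v = 0)
    (hnd : ∀ v, (∀ w, b v w = 0) → v = 0)
    (hinv : ∀ v w, b (u v) (u w) = b v w) :
    -- (i) ↔ (ii)
    ((∃ (r : ℕ) (w : (Fin r → K) ≃ₗ[K] (Fin r → K)),
        IsUnipotent K (w : (Fin r → K) →ₗ[K] (Fin r → K)) ∧
        (∃ k : ℕ, w ^ (2 ^ k) = 1) ∧ IsPairedIso u b w) ↔
      (∃ W W' : Submodule K Z, IsCompl W W' ∧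
        (∀ x ∈ W, u x ∈ W) ∧ (∀ x ∈ W', u x ∈ W') ∧
        (∀ x ∈ W, ∀ y ∈ W, b x y = 0) ∧ (∀ x ∈ W', ∀ y ∈ W', b x y = 0))) ∧
    -- (ii) ↔ (iii)
    ((∃ W W' : Submodule K Z, IsCompl W W' ∧
        (∀ x ∈ W, u x ∈ W) ∧ (∀ x ∈ W', u x ∈ W') ∧
        (∀ x ∈ W, ∀ y ∈ W, b x y = 0) ∧ (∀ x ∈ W', ∀ y ∈ W', b x y = 0)) ↔
      (∀ d : ℕ, 1 ≤ d → eps K ((u : Z →ₗ[K] Z) - 1) b d = 0)) ∧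
    -- moreover
    (∀ W W' : Submodule K Z, IsCompl W W' →
      (∀ x ∈ W, u x ∈ W) → (∀ x ∈ W', u x ∈ W') →
      (∀ x ∈ W, ∀ y ∈ W, b x y = 0) → (∀ x ∈ W', ∀ y ∈ W', b x y = 0) →
      ∃ w : ↥W ≃ₗ[K] ↥W, (∀ x : W, (w x : Z) = u (x : Z)) ∧
        (∀ d : ℕ, 1 ≤ d →
          jordanMult K ((u : Z →ₗ[K] Z) - 1) d =
            2 * jordanMult K ((w : ↥W →ₗ[K] ↥W) - 1) d) ∧
        IsPairedIso u b w) := by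
  have h2 : (2 : K) = 0 := by exact_mod_cast CharP.cast_eq_zero K 2
  have hsym : ∀ x y, b x y = b y x := by
    intro x y
    have := halt (x + y)
    simp only [map_add, LinearMap.add_apply, halt] at this
    linear_combination this - b y x * h2
  set f : Z →ₗ[K] Z := (u : Z →ₗ[K] Z) - 1 with hfdef
  have hfu : ∀ x, f x = u x - x := fun x => rfl
  have hf : ∀ x y, b x (f y) = b (f x) y + b (f x) (f y) := by
    intro x y
    simp only [hfu, map_sub, LinearMap.sub_apply, hinv]
    linear_combination (b x (u y) - b x y) * h2
  have heps : (∀ d : ℕ, 1 ≤ d → eps K f b d = 0) ↔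
      ∀ d x, (f^(d+1)) x = 0 → b ((f^d) x) x = 0 := by
    constructor
    · intro h d x hx
      have := h (d+1) (by omega)
      unfold eps at this
      by_contra hne
      rw [if_pos ⟨x, hx, by simpa using hne⟩] at this
      exact one_ne_zero this
    · intro h d hd
      obtain ⟨d, rfl⟩ : ∃ e, d = e + 1 := ⟨d - 1, by omega⟩
      unfold eps
      rw [if_neg]
      rintro ⟨x, hx, hne⟩
      exact hne (by simpa using h d x hx)
  have hrestr : ∀ W : Submodule K Z, (∀ x ∈ W, u x ∈ W) →
      ∃ w : W ≃ₗ[K] W, ∀ x : W, (w x : Z) = u (x : Z) := by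
    intro W hW
    let g : W →ₗ[K] W := (u : Z →ₗ[K] Z).restrict hW
    have hg : Function.Injective g := by
      intro x y hxy
      exact Subtype.ext (u.injective (congrArg Subtype.val hxy))
    exact ⟨LinearEquiv.ofInjectiveEndo g hg, fun x => rfl⟩
  refine ⟨⟨?_, ?_⟩, ⟨?_, ?_⟩, ?_⟩
  · rintro ⟨r, w, -, -, φ, hφ, hb⟩
    refine ⟨LinearMap.ker (LinearMap.snd K _ _ ∘ₗ φ.toLinearMap),
      LinearMap.ker (LinearMap.fst K _ _ ∘ₗ φ.toLinearMap), ⟨?_, ?_⟩, ?_, ?_, ?_, ?_⟩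
    · rw [Submodule.disjoint_def]
      intro x hx hx'
      simp at hx hx'
      apply φ.injective
      rw [map_zero]
      exact Prod.ext hx' hx
    · rw [codisjoint_iff, eq_top_iff]
      intro z _
      rw [Submodule.mem_sup]
      refine ⟨φ.symm ((φ z).1, 0), by simp, φ.symm (0, (φ z).2), by simp, ?_⟩
      rw [← map_add]
      simp
    · intro x hx
      simp at hx ⊢
      rw [hφ, hx]
      exact map_zero _
    · intro x hx
      simp at hx ⊢
      rw [hφ, hx]
      exact map_zero _
    · intro x hx y hy
      simp at hx hy
      rw [hb, hx, hy]; simp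
    · intro x hx y hy
      simp at hx hy
      rw [hb, hx, hy]; simp
  · rintro ⟨W, W', hc, hW, hW', hs, hs'⟩
    obtain ⟨w, hw⟩ := hrestr W hW
    obtain ⟨φ, hφ, hb⟩ := pm_pairedIso u b hsym hnd hinv W W' hc hW' hs hs' w hw
    let e : W ≃ₗ[K] (Fin (Module.finrank K W) → K) := (Module.finBasis K W).equivFun
    let w' := (e.symm.trans w).trans e
    have hw' : ∀ x, w' x = e (w (e.symm x)) := fun x => rfl
    refine ⟨Module.finrank K W, w', ?_, ?_, ?_⟩
    · obtain ⟨n, hn⟩ := huni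
      refine ⟨n, ?_⟩
      have key : ∀ k x, ((e.symm (((w'.toLinearMap - 1)^k) x) : W) : Z) =
          (f^k) (e.symm x : W) := by
        intro k
        induction k with
        | zero => intro x; rfl
        | succ k ih =>
          intro x
          rw [pow_succ, Module.End.mul_apply, ih, pow_succ, Module.End.mul_apply]
          congr 1
          simp [hw', hw, hfu]
      apply LinearMap.ext
      intro x
      apply e.symm.injective
      apply Subtype.ext
      rw [key, hn]
      simp
    · obtain ⟨k, hk⟩ := hord
      refine ⟨k, ?_⟩
      have key : ∀ k x, ((e.symm ((w'^k) x) : W) : Z) = (u^k) (e.symm x : W) := by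
        intro k
        induction k with
        | zero => intro x; rfl
        | succ k ih =>
          intro x
          rw [pow_succ, LinearEquiv.mul_apply, ih, pow_succ, LinearEquiv.mul_apply]
          congr 1
          simp [hw', hw]
      apply LinearEquiv.ext
      intro x
      apply e.symm.injective
      apply Subtype.ext
      rw [key, hk]
      simp
    · refine ⟨φ.trans (LinearEquiv.prodCongr e e.symm.dualMap), ?_, ?_⟩
      · intro z
        refine Prod.ext ?_ ?_
        · simp [hφ, hw']
        · apply LinearMap.ext
          intro m
          simp [hφ, w']
      · intro z z'
        rw [hb]
        simp
  · rintro ⟨W, W', hc, hW, hW', hs, hs'⟩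
    rw [heps]
    intro d x hx
    have hWp : ∀ V : Submodule K Z, (∀ x ∈ V, u x ∈ V) → ∀ (i : ℕ), ∀ x ∈ V, (f^i) x ∈ V := by
      intro V hV i
      induction i with
      | zero => intro x hx; simpa using hx
      | succ i ih =>
        intro x hx
        rw [pow_succ', Module.End.mul_apply, hfu]
        exact V.sub_mem (hV _ (ih x hx)) (ih x hx)
    obtain ⟨p, hp, q, hq, rfl⟩ := Submodule.mem_sup.1
      (show x ∈ W ⊔ W' by rw [hc.sup_eq_top]; trivial)
    have hp0 : (f^(d+1)) p = 0 := by
      rw [map_add] at hx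
      refine Submodule.disjoint_def.1 hc.disjoint _ (hWp W hW _ p hp) ?_
      rw [eq_neg_of_add_eq_zero_left hx]
      exact W'.neg_mem (hWp W' hW' _ q hq)
    have h1 := pm_B1 f b hf p q d hp0 0 d (by omega)
    simp only [pow_zero, Module.End.one_apply] at h1
    simp only [map_add, LinearMap.add_apply]
    rw [hs _ (hWp W hW _ p hp) p hp, hs' _ (hWp W' hW' _ q hq) q hq, hsym _ p, h1]
    linear_combination b ((f^d) p) q * h2
  · intro h
    obtain ⟨W, W', hg, hc⟩ := pm_exists f b hf halt hsym hnd huni (heps.1 h)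
    have hu : ∀ x, u x = f x + x := fun x => by rw [hfu]; abel
    refine ⟨W, W', hc, ?_, ?_, hg.sing, hg.sing'⟩
    · intro x hx; rw [hu]; exact W.add_mem (hg.inv x hx) hx
    · intro x hx; rw [hu]; exact W'.add_mem (hg.inv' x hx) hx
  · intro W W' hc hW hW' hs hs'
    obtain ⟨w, hw⟩ := hrestr W hW
    have hp := pm_pairedIso u b hsym hnd hinv W W' hc hW' hs hs' w hw
    refine ⟨w, hw, ?_, hp⟩
    intro d _
    unfold jordanMult
    rw [pm_rank u b w hp, pm_rank u b w hp, pm_rank u b w hp]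
    omega
end

section
/- Let (V,b) be an alternating bilinear K[u]-module (not necessarily non-degenerate) and d ≥ 1. Then there exists v ∈ V with X^d v = 0 and b(X^{d−1}v, v) ≠ 0 if and only if there exists a u-invariant d-dimensional subspace W ⊆ V on which u acts as a single Jordan block of size d and such that the restriction of b to W × W is non-degenerate; moreover, in that case d is even and V = W ⊥ W^⊥. -/
open Module LinearMap

/-- Triangular coefficient extraction. -/
theorem aux_triangular {K V M : Type*} [Field K] [AddCommGroup V] [Module K V]
    [AddCommGroup M] [Module K M] {d : ℕ} (e : Fin d → V) (T : Fin d → V →ₗ[K] M)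
    (h0 : ∀ k i, k < i → T k (e i) = 0) (h1 : ∀ k, T k (e k) ≠ 0)
    (a : Fin d → K) (hx : ∀ k, T k (∑ i, a i • e i) = 0) : ∀ k, a k = 0 := by
  intro k
  induction k using WellFoundedLT.induction with
  | ind k ih =>
    have h := hx k
    rw [map_sum, Finset.sum_eq_single k] at h
    · rw [map_smul] at h
      exact (smul_eq_zero.mp h).resolve_right (h1 k)
    · intro i _ hik
      rcases lt_or_gt_of_ne hik with h' | h'
      · simp [ih i h']
      · simp [h0 k i h']
    · simp

/-- Powers of a nilpotent map on a vector are linearly independent. -/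
theorem aux_linInd {K V : Type*} [Field K] [AddCommGroup V] [Module K V]
    (X : V →ₗ[K] V) {d : ℕ} {v : V} (hv : (X ^ d) v = 0) (hv' : (X ^ (d - 1)) v ≠ 0) :
    LinearIndependent K (fun i : Fin d => (X ^ (i : ℕ)) v) := by
  rw [Fintype.linearIndependent_iff]
  intro a ha
  refine aux_triangular (fun i : Fin d => (X ^ (i : ℕ)) v)
    (fun k : Fin d => X ^ (d - 1 - (k : ℕ))) ?_ ?_ a ?_
  · intro k i hki
    have hki' : (k : ℕ) < i := hki
    rw [← Module.End.mul_apply, ← pow_add]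
    have : d - 1 - (k : ℕ) + i = (i - k - 1) + d := by omega
    rw [this, pow_add, Module.End.mul_apply, hv, map_zero]
  · intro k
    rw [← Module.End.mul_apply, ← pow_add]
    have : d - 1 - (k : ℕ) + k = d - 1 := by omega
    rwa [this]
  · intro k
    rw [ha, map_zero]

theorem aux_vanish {K V : Type*} [Field K] [AddCommGroup V] [Module K V]
    (X : V →ₗ[K] V) (b : V →ₗ[K] V →ₗ[K] K)
    (hX : ∀ v w, b v (X w) = - b (X v) w - b (X v) (X w))
    {d : ℕ} {v : V} (hv : (X ^ d) v = 0) (w : V) :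
    ∀ n i j : ℕ, d ≤ i + n → d ≤ i + j → b ((X ^ i) v) ((X ^ j) w) = 0 := by
  have hge : ∀ i, d ≤ i → (X ^ i) v = 0 := by
    intro i hi
    obtain ⟨k, rfl⟩ := Nat.exists_eq_add_of_le hi
    rw [add_comm, pow_add, Module.End.mul_apply, hv, map_zero]
  intro n
  induction n with
  | zero =>
    intro i j h _
    rw [hge i h]; simp
  | succ n ih =>
    intro i j h h'
    cases j with
    | zero => rw [hge i h']; simp
    | succ j =>
      have e1 := ih (i + 1) j (by omega) (by omega)
      have e2 := ih (i + 1) (j + 1) (by omega) (by omega)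
      rw [pow_succ' X i, Module.End.mul_apply] at e1 e2
      rw [pow_succ' X j, Module.End.mul_apply] at e2 ⊢
      rw [hX, e1, e2]; simp

theorem aux_flip {K V : Type*} [Field K] [AddCommGroup V] [Module K V]
    (X : V →ₗ[K] V) (b : V →ₗ[K] V →ₗ[K] K)
    (hX : ∀ v w, b v (X w) = - b (X v) w - b (X v) (X w))
    {d : ℕ} {v : V} (hv : (X ^ d) v = 0) :
    ∀ j i : ℕ, i + j + 1 = d →
      (b ((X ^ i) v) ((X ^ j) v) = 0 ↔ b ((X ^ (d - 1)) v) v = 0) := by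
  intro j
  induction j with
  | zero =>
    intro i h
    have : i = d - 1 := by omega
    subst this; simp
  | succ j ih =>
    intro i h
    rw [← ih (i + 1) (by omega)]
    have e2 := aux_vanish X b hX hv v d (i + 1) (j + 1) (by omega) (by omega)
    rw [pow_succ' X i, Module.End.mul_apply] at e2 ⊢
    rw [pow_succ' X j, Module.End.mul_apply] at e2 ⊢
    rw [hX, e2]; simp

/-- Lemma on ε: for an alternating bilinear `K[u]`-module `(V,b)` (possibly
degenerate) and `d ≥ 1`, there is `v` with `X^d v = 0` and `b(X^{d-1}v, v) ≠ 0` iff there is a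
`u`-invariant `d`-dimensional subspace `W` on which `u` acts as a single Jordan block of size `d`
and on which `b` restricts non-degenerately; in that case `d` is even and `V = W ⊥ W^⊥`. -/
theorem eps_iff_nondegenerate_single_block_summand
    (K : Type*) [Field K] [IsAlgClosed K] [CharP K 2]
    (V : Type*) [AddCommGroup V] [Module K V] [FiniteDimensional K V]
    (u : V ≃ₗ[K] V) (huni : IsUnipotent K (u : V →ₗ[K] V))
    (hord : ∃ k : ℕ, u ^ (2 ^ k) = 1)
    (b : V →ₗ[K] V →ₗ[K] K)
    (halt : ∀ v, b v v = 0)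
    (hinv : ∀ v w, b (u v) (u w) = b v w)
    (d : ℕ) (hd : 1 ≤ d) :
    ((∃ v : V, (((u : V →ₗ[K] V) - 1) ^ d) v = 0 ∧
        b ((((u : V →ₗ[K] V) - 1) ^ (d - 1)) v) v ≠ 0) ↔
      (∃ W : Submodule K V, Module.finrank K ↥W = d ∧ (∀ x ∈ W, u x ∈ W) ∧
        (∃ x ∈ W, (((u : V →ₗ[K] V) - 1) ^ (d - 1)) x ≠ 0) ∧
        (∀ x ∈ W, (∀ y ∈ W, b x y = 0) → x = 0))) ∧
    (∀ W : Submodule K V, Module.finrank K ↥W = d → (∀ x ∈ W, u x ∈ W) →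
      (∃ x ∈ W, (((u : V →ₗ[K] V) - 1) ^ (d - 1)) x ≠ 0) →
      (∀ x ∈ W, (∀ y ∈ W, b x y = 0) → x = 0) →
      Even d ∧ IsCompl W (LinearMap.BilinForm.orthogonal b W)) := by
  set X : V →ₗ[K] V := (u : V →ₗ[K] V) - 1 with hXdef
  have hXa : ∀ v, X v = u v - v := fun v => rfl
  have hX : ∀ v w, b v (X w) = - b (X v) w - b (X v) (X w) := by
    intro v w
    simp only [hXa, map_sub, LinearMap.sub_apply, hinv]
    ring
  -- structure of single-block nondegenerate subspaces
  have key : ∀ W : Submodule K V, Module.finrank K ↥W = d → (∀ x ∈ W, u x ∈ W) →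
      (∀ x ∈ W, (∀ y ∈ W, b x y = 0) → x = 0) →
      ∀ x ∈ W, (X ^ (d - 1)) x ≠ 0 → (X ^ d) x = 0 ∧ b ((X ^ (d - 1)) x) x ≠ 0 := by
    intro W hW hu hnd x hx hxne
    have hXW : ∀ y ∈ W, X y ∈ W := fun y hy => W.sub_mem (hu y hy) hy
    have hXpow : ∀ n : ℕ, ∀ y ∈ W, (X ^ n) y ∈ W := by
      intro n
      induction n with
      | zero => intro y hy; simpa using hy
      | succ n ih =>
        intro y hy
        rw [pow_succ', Module.End.mul_apply]
        exact hXW _ (ih y hy)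
    have hXd : (X ^ d) x = 0 := by
      obtain ⟨N, hN⟩ := huni
      have hr : ∀ n : ℕ, ∀ y : W, (((X.restrict hXW) ^ n) y : V) = (X ^ n) (y : V) := by
        intro n
        induction n with
        | zero => intro y; simp
        | succ n ih =>
          intro y
          rw [pow_succ', pow_succ', Module.End.mul_apply, Module.End.mul_apply, ← ih y]
          rfl
      have hm : (⟨x, hx⟩ : W) ∈ LinearMap.ker ((X.restrict hXW) ^ N) := by
        rw [LinearMap.mem_ker]
        apply Subtype.ext
        rw [hr, hXdef, hN]; simp
      have h2 := Module.End.ker_pow_le_ker_pow_finrank (X.restrict hXW) N hm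
      rw [hW, LinearMap.mem_ker] at h2
      have h3 := congrArg Subtype.val h2
      rw [hr] at h3
      simpa using h3
    refine ⟨hXd, fun hc => hxne ?_⟩
    have hli := aux_linInd X hXd hxne
    have hspan : Submodule.span K (Set.range fun i : Fin d => (X ^ (i : ℕ)) x) = W := by
      apply Submodule.eq_of_le_of_finrank_eq
      · rw [Submodule.span_le]
        rintro _ ⟨i, rfl⟩
        exact hXpow i x hx
      · rw [finrank_span_eq_card hli, hW, Fintype.card_fin]
    apply hnd _ (hXpow _ x hx)
    intro y hy
    rw [← hspan] at hy
    have hle : Submodule.span K (Set.range fun i : Fin d => (X ^ (i : ℕ)) x) ≤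
        LinearMap.ker (b ((X ^ (d - 1)) x)) := by
      rw [Submodule.span_le]
      rintro _ ⟨i, rfl⟩
      change b ((X ^ (d - 1)) x) ((X ^ (i : ℕ)) x) = 0
      rcases Nat.eq_zero_or_pos (i : ℕ) with h | h
      · rw [h]; simpa using hc
      · exact aux_vanish X b hX hXd x d _ _ (by omega) (by omega)
    exact hle hy
  refine ⟨⟨?_, ?_⟩, ?_⟩
  · rintro ⟨v, hv, hc⟩
    have hne : (X ^ (d - 1)) v ≠ 0 := by
      intro h
      apply hc
      rw [h]; simp
    have hli := aux_linInd X hv hne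
    have hmem : ∀ i : ℕ, (X ^ i) v ∈
        Submodule.span K (Set.range fun i : Fin d => (X ^ (i : ℕ)) v) := by
      intro i
      by_cases hi : i < d
      · exact Submodule.subset_span ⟨⟨i, hi⟩, rfl⟩
      · obtain ⟨k, rfl⟩ := Nat.exists_eq_add_of_le (not_lt.mp hi)
        rw [add_comm, pow_add, Module.End.mul_apply, hv, map_zero]
        exact Submodule.zero_mem _
    refine ⟨Submodule.span K (Set.range fun i : Fin d => (X ^ (i : ℕ)) v), ?_, ?_, ?_, ?_⟩
    · rw [finrank_span_eq_card hli, Fintype.card_fin]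
    · have hle : Submodule.span K (Set.range fun i : Fin d => (X ^ (i : ℕ)) v) ≤
          (Submodule.span K (Set.range fun i : Fin d => (X ^ (i : ℕ)) v)).comap
            (u : V →ₗ[K] V) := by
        rw [Submodule.span_le]
        rintro _ ⟨i, rfl⟩
        rw [SetLike.mem_coe, Submodule.mem_comap]
        change u ((X ^ (i : ℕ)) v) ∈ Submodule.span K (Set.range fun i : Fin d => (X ^ (i : ℕ)) v)
        have h1 : u ((X ^ (i : ℕ)) v) = (X ^ ((i : ℕ) + 1)) v + (X ^ (i : ℕ)) v := by
          rw [pow_succ', Module.End.mul_apply, hXa]; simp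
        rw [h1]
        exact Submodule.add_mem _ (hmem _) (hmem _)
      exact fun x hx => hle hx
    · exact ⟨v, by simpa using hmem 0, hne⟩
    · intro x hx hb
      obtain ⟨a, rfl⟩ := (Submodule.mem_span_range_iff_exists_fun K).mp hx
      have ha : ∀ k, a k = 0 := by
        refine aux_triangular (fun i : Fin d => (X ^ (i : ℕ)) v)
          (fun k : Fin d => b.flip ((X ^ (d - 1 - (k : ℕ))) v)) ?_ ?_ a ?_
        · intro k i hki
          have hki' : (k : ℕ) < i := hki
          exact aux_vanish X b hX hv v d _ _ (by omega) (by omega)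
        · intro k h
          exact hc ((aux_flip X b hX hv (d - 1 - (k : ℕ)) k (by omega)).mp h)
        · intro k
          exact hb _ (hmem _)
      simp [ha]
  · rintro ⟨W, hW, hu, ⟨x, hx, hxne⟩, hnd⟩
    exact ⟨x, key W hW hu hnd x hx hxne⟩
  · rintro W hW hu ⟨x, hx, hxne⟩ hnd
    obtain ⟨hxd, hc⟩ := key W hW hu hnd x hx hxne
    constructor
    · by_contra hodd
      rw [Nat.not_even_iff_odd] at hodd
      obtain ⟨m, hm⟩ := hodd
      exact hc ((aux_flip X b hX hxd m m (by omega)).mp (halt _))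
    · have hrefl : LinearMap.BilinForm.IsRefl b := LinearMap.IsAlt.isRefl (B := b) halt
      apply LinearMap.BilinForm.isCompl_orthogonal_of_restrict_nondegenerate hrefl
      constructor
      · intro y hy
        apply Subtype.ext
        exact hnd y y.2 fun z hz => hy ⟨z, hz⟩
      · intro y hy
        apply Subtype.ext
        exact hnd y y.2 fun z hz => hrefl _ _ (hy ⟨z, hz⟩)
end

section
/- Let (V,b) be a non-degenerate alternating bilinear K[u]-module. Then: (i) if d is odd, ε_{V,b}(d) = 0; (ii) if some Jordan block size d of u on V occurs with odd multiplicity, then d is even and ε_{V,b}(d) = 1. -/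
open Module LinearMap

theorem alt_rank_even {K : Type*} [Field K] (n : ℕ) : ∀ {W : Type _} [AddCommGroup W] [Module K W]
    [FiniteDimensional K W] (B : W →ₗ[K] W →ₗ[K] K), (∀ v, B v v = 0) → finrank K W = n →
    ∃ k, finrank K W = finrank K (LinearMap.ker B) + 2 * k := by
  induction n using Nat.strong_induction_on with
  | _ n ih =>
  intro W _ _ _ B hB hn
  have hneg : ∀ v w, B v w = - B w v := fun v w => (LinearMap.IsAlt.neg (B := B) hB w v).symm
  by_cases h0 : B = 0
  · refine ⟨0, ?_⟩
    have hk : LinearMap.ker B = ⊤ := LinearMap.ker_eq_top.2 h0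
    rw [hk, finrank_top, mul_zero, add_zero]
  obtain ⟨x, y', hxy'⟩ : ∃ x y, B x y ≠ 0 := by
    by_contra! h
    exact h0 (LinearMap.ext fun x => LinearMap.ext fun y => h x y)
  obtain ⟨y, hxy⟩ : ∃ y, B x y = 1 := ⟨(B x y')⁻¹ • y', by simp [hxy']⟩
  have hyx : B y x = -1 := by rw [hneg, hxy]
  let φ : W →ₗ[K] K × K := (B x).prod (B y)
  have hφ : LinearMap.range φ = ⊤ := by
    rw [LinearMap.range_eq_top]
    rintro ⟨a, c⟩
    refine ⟨a • y - c • x, ?_⟩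
    simp [φ, hB, hxy, hyx]
  have hdim := φ.finrank_range_add_finrank_ker
  rw [hφ, finrank_top, Module.finrank_prod, Module.finrank_self] at hdim
  set U := LinearMap.ker φ with hU
  have hmem : ∀ v, v ∈ U ↔ B x v = 0 ∧ B y v = 0 := by
    intro v; simp [hU, φ, LinearMap.mem_ker]
  let BU : U →ₗ[K] U →ₗ[K] K := B.compl₁₂ U.subtype U.subtype
  obtain ⟨k, hk⟩ := ih (finrank K U) (by omega) BU (fun v => hB v) rfl
  have hker : (LinearMap.ker BU).map U.subtype = LinearMap.ker B := by
    ext v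
    constructor
    · rintro ⟨⟨v, hv⟩, hv', rfl⟩
      rw [LinearMap.mem_ker]
      ext w
      have h2 := (hmem v).1 hv
      have hw : w - B x w • y + B y w • x ∈ U := by
        rw [hmem]; simp [hB, hxy, hyx]
      have h1 : B v (w - B x w • y + B y w • x) = 0 :=
        LinearMap.congr_fun (LinearMap.mem_ker.1 hv') ⟨_, hw⟩
      simpa [hneg v x, hneg v y, h2.1, h2.2] using h1
    · intro hv
      rw [LinearMap.mem_ker] at hv
      have hvU : v ∈ U := by
        rw [hmem, hneg x, hneg y]; simp [hv]
      refine ⟨⟨v, hvU⟩, ?_, rfl⟩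
      rw [SetLike.mem_coe, LinearMap.mem_ker]
      ext w
      simp [BU, hv]
  have hf : finrank K (LinearMap.ker BU) = finrank K (LinearMap.ker B) := by
    rw [← hker]
    exact (LinearEquiv.finrank_eq (Submodule.equivMapOfInjective _ U.injective_subtype _))
  exact ⟨k + 1, by omega⟩

theorem adj_pow {K V : Type*} [Field K] [AddCommGroup V] [Module K V]
    (u : V ≃ₗ[K] V) (b : V →ₗ[K] V →ₗ[K] K)
    (hinv : ∀ v w, b (u v) (u w) = b v w) (k : ℕ) : ∀ v w,
    b ((((u : V →ₗ[K] V) - 1) ^ k) v) (((u : V →ₗ[K] V) ^ k) w) =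
      (-1) ^ k * b v ((((u : V →ₗ[K] V) - 1) ^ k) w) := by
  induction k with
  | zero => simp
  | succ k ih =>
    intro v w
    have h1 : ∀ a c, b (((u : V →ₗ[K] V) - 1) a) (u c) = - b a (((u : V →ₗ[K] V) - 1) c) := by
      intro a c
      simp [hinv]
    have hc : Commute ((u : V →ₗ[K] V) - 1) ((u : V →ₗ[K] V) ^ k) :=
      ((Commute.refl (u : V →ₗ[K] V)).sub_left (Commute.one_left _)).pow_right k
    rw [pow_succ' ((u : V →ₗ[K] V) - 1), pow_succ' (u : V →ₗ[K] V), Module.End.mul_apply,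
      Module.End.mul_apply, LinearEquiv.coe_coe, h1, ← Module.End.mul_apply, hc.eq,
      Module.End.mul_apply, ih, ← Module.End.mul_apply, ← pow_succ, ← pow_succ']
    ring

theorem fix_pow {K V : Type*} [Field K] [AddCommGroup V] [Module K V]
    (u : V ≃ₗ[K] V) (b : V →ₗ[K] V →ₗ[K] K)
    (hinv : ∀ v w, b (u v) (u w) = b v w) (z v : V) (hz : ((u : V →ₗ[K] V) - 1) z = 0) (k : ℕ) :
    b z (((u : V →ₗ[K] V) ^ k) v) = b z v := by
  have hz' : u z = z := by simpa [sub_eq_zero] using hz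
  induction k with
  | zero => simp
  | succ k ih =>
    rw [pow_succ', Module.End.mul_apply, LinearEquiv.coe_coe]
    conv_lhs => rw [← hz']
    rw [hinv, ih]

theorem odd_case {K V : Type*} [Field K] [AddCommGroup V] [Module K V]
    (u : V ≃ₗ[K] V) (b : V →ₗ[K] V →ₗ[K] K) (halt : ∀ v, b v v = 0)
    (hinv : ∀ v w, b (u v) (u w) = b v w) (d : ℕ) (hd : Odd d) :
    eps K ((u : V →ₗ[K] V) - 1) b d = 0 := by
  obtain ⟨k, rfl⟩ := hd
  unfold eps
  rw [if_neg]
  rintro ⟨v, hv, hne⟩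
  apply hne
  rw [← fix_pow u b hinv _ v _ k, Nat.add_sub_cancel, two_mul, pow_add, Module.End.mul_apply,
    adj_pow u b hinv, halt, mul_zero]
  rw [← Module.End.mul_apply, ← pow_succ']
  exact hv

/-- The annihilator of `ker X^d` is `im X^d`. -/
theorem orth_ker {K V : Type*} [Field K] [AddCommGroup V] [Module K V] [FiniteDimensional K V]
    (u : V ≃ₗ[K] V) (b : V →ₗ[K] V →ₗ[K] K) (halt : ∀ v, b v v = 0)
    (hnd : ∀ v, (∀ w, b v w = 0) → v = 0)
    (hinv : ∀ v w, b (u v) (u w) = b v w) (d : ℕ) (v : V) :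
    (∀ w, (((u : V →ₗ[K] V) - 1) ^ d) w = 0 → b v w = 0) ↔
      v ∈ LinearMap.range (((u : V →ₗ[K] V) - 1) ^ d) := by
  set X := (u : V →ₗ[K] V) - 1 with hX
  have hneg : ∀ v w, b v w = - b w v := fun v w => (LinearMap.IsAlt.neg (B := b) halt w v).symm
  have key : LinearMap.range (X ^ d) = LinearMap.BilinForm.orthogonal b (LinearMap.ker (X ^ d)) := by
    apply Submodule.eq_of_le_of_finrank_eq
    · rintro _ ⟨z, rfl⟩ w hw
      rw [LinearMap.mem_ker] at hw
      change b w _ = 0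
      have hc : Commute X ((u : V →ₗ[K] V)) :=
        ((Commute.refl (u : V →ₗ[K] V)).sub_left (Commute.one_left _))
      have hcd : Commute (X ^ d) ((u : V →ₗ[K] V) ^ d) := hc.pow_pow d d
      have hinj : Function.Injective ((u : V →ₗ[K] V) ^ d) := by
        rw [Module.End.coe_pow]; exact u.injective.iterate d
      have hsurj : Function.Surjective ((u : V →ₗ[K] V) ^ d) := by
        rw [Module.End.coe_pow]; exact u.surjective.iterate d
      obtain ⟨w', rfl⟩ := hsurj w
      rw [← Module.End.mul_apply, hcd.eq, Module.End.mul_apply] at hw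
      have hw' : (X ^ d) w' = 0 := hinj (by rw [hw, map_zero])
      rw [hneg, adj_pow u b hinv, ← hX, hw']
      simp
    · have hr : LinearMap.BilinForm.IsRefl b := LinearMap.BilinForm.IsAlt.isRefl halt
      have h1 := LinearMap.BilinForm.finrank_add_finrank_orthogonal' (B := b) (LinearMap.ker (X ^ d))
      have hk : LinearMap.ker b = ⊥ := by
        rw [eq_bot_iff]
        intro v hv
        rw [LinearMap.mem_ker] at hv
        exact hnd v (fun w => by simp [hv])
      rw [hk, inf_bot_eq, finrank_bot] at h1
      have h2 := (X ^ d).finrank_range_add_finrank_ker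
      omega
  rw [key, LinearMap.BilinForm.mem_orthogonal_iff]
  constructor
  · intro h w hw
    change b w v = 0
    rw [hneg, h w hw, neg_zero]
  · intro h w hw
    rw [hneg, show b w v = 0 from h w hw, neg_zero]

theorem even_mult {K V : Type*} [Field K] [AddCommGroup V] [Module K V] [FiniteDimensional K V]
    (u : V ≃ₗ[K] V) (b : V →ₗ[K] V →ₗ[K] K) (halt : ∀ v, b v v = 0)
    (hnd : ∀ v, (∀ w, b v w = 0) → v = 0)
    (hinv : ∀ v w, b (u v) (u w) = b v w) (e : ℕ)
    (h : ∀ v, (((u : V →ₗ[K] V) - 1) ^ (e + 1)) v = 0 →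
      b ((((u : V →ₗ[K] V) - 1) ^ e) v) v = 0) :
    Even (jordanMult K ((u : V →ₗ[K] V) - 1) (e + 1)) := by
  have ho := orth_ker u b halt hnd hinv (e + 1)
  unfold jordanMult
  set X := (u : V →ₗ[K] V) - 1 with hX
  rw [Nat.add_sub_cancel]
  set W := LinearMap.ker (X ^ (e + 1)) with hW
  let β : W →ₗ[K] W →ₗ[K] K := b.compl₁₂ ((X ^ e).comp W.subtype) W.subtype
  obtain ⟨k, hk⟩ := alt_rank_even _ β (fun v => h v v.2) rfl
  -- the restriction of `X^e` to the radical
  let ψ : LinearMap.ker β →ₗ[K] V := ((X ^ e).comp W.subtype).comp (LinearMap.ker β).subtype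
  have hβ : ∀ w : W, w ∈ LinearMap.ker β ↔ (X ^ e) w ∈ LinearMap.range (X ^ (e + 1)) := by
    intro w
    rw [← ho, LinearMap.mem_ker]
    constructor
    · intro hw z hz
      exact LinearMap.congr_fun hw ⟨z, hz⟩
    · intro hw
      ext z
      exact hw z z.2
  have h1 : LinearMap.range ψ = (LinearMap.ker (X.comp (X ^ (e+1)).range.subtype)).map
      (X ^ (e+1)).range.subtype := by
    ext y
    constructor
    · rintro ⟨⟨w, hw⟩, rfl⟩
      refine ⟨⟨(X ^ e) w, (hβ w).1 hw⟩, ?_, rfl⟩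
      have : (X ^ (e + 1)) (w : V) = 0 := w.2
      rw [pow_succ', Module.End.mul_apply] at this
      exact this
    · rintro ⟨⟨_, z, rfl⟩, hy, rfl⟩
      have hy' : X ((X ^ (e + 1)) z) = 0 := hy
      have hz : X z ∈ W := by
        rw [hW, LinearMap.mem_ker, ← Module.End.mul_apply, ← pow_succ, pow_succ']
        exact hy'
      have he : (X ^ e) (X z) = (X ^ (e + 1)) z := by
        rw [← Module.End.mul_apply, ← pow_succ]
      exact ⟨⟨⟨X z, hz⟩, (hβ _).2 ⟨z, he.symm⟩⟩, he⟩
  have h2 : ((LinearMap.ker ψ).map (LinearMap.ker β).subtype).map W.subtype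
      = LinearMap.ker (X ^ e) := by
    ext v
    constructor
    · rintro ⟨_, ⟨⟨w, hw⟩, hv, rfl⟩, rfl⟩
      exact hv
    · intro hv
      rw [LinearMap.mem_ker] at hv
      have hvW : v ∈ W := by
        rw [hW, LinearMap.mem_ker, pow_succ', Module.End.mul_apply, hv, map_zero]
      have hvβ : (⟨v, hvW⟩ : W) ∈ LinearMap.ker β := by
        rw [hβ]
        change (X ^ e) v ∈ _
        rw [hv]; exact zero_mem _
      exact ⟨⟨v, hvW⟩, ⟨⟨⟨v, hvW⟩, hvβ⟩, hv, rfl⟩, rfl⟩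
  have f1 := congrArg (fun S : Submodule K V => finrank K S) h1
  have f2 := congrArg (fun S : Submodule K V => finrank K S) h2
  simp only [Submodule.finrank_map_subtype_eq] at f1 f2
  have g1 := ψ.finrank_range_add_finrank_ker
  have g2 := (X.comp (X ^ (e+1)).range.subtype).finrank_range_add_finrank_ker
  have g3 : LinearMap.range (X.comp (X ^ (e+1)).range.subtype) = LinearMap.range (X ^ (e + 1 + 1)) := by
    rw [LinearMap.range_comp, Submodule.range_subtype, ← LinearMap.range_comp, pow_succ' X (e + 1)]
    rfl
  rw [g3] at g2
  have g4 := (X ^ e).finrank_range_add_finrank_ker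
  have g5 := (X ^ (e + 1)).finrank_range_add_finrank_ker
  rw [← hW] at g5
  exact ⟨k, by omega⟩

/-- for a non-degenerate alternating bilinear `K[u]`-module `(V,b)`:
(i) `ε_{V,b}(d) = 0` for odd `d`; (ii) a Jordan block size of odd multiplicity is even and has
`ε_{V,b}(d) = 1`. -/
theorem eps_odd_eq_zero_and_odd_multiplicity
    (K : Type*) [Field K] [IsAlgClosed K] [CharP K 2]
    (V : Type*) [AddCommGroup V] [Module K V] [FiniteDimensional K V]
    (u : V ≃ₗ[K] V) (huni : IsUnipotent K (u : V →ₗ[K] V))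
    (hord : ∃ k : ℕ, u ^ (2 ^ k) = 1)
    (b : V →ₗ[K] V →ₗ[K] K)
    (halt : ∀ v, b v v = 0)
    (hnd : ∀ v, (∀ w, b v w = 0) → v = 0)
    (hinv : ∀ v w, b (u v) (u w) = b v w) :
    ∀ d : ℕ, 1 ≤ d →
      (Odd d → eps K ((u : V →ₗ[K] V) - 1) b d = 0) ∧
      (Odd (jordanMult K ((u : V →ₗ[K] V) - 1) d) →
        Even d ∧ eps K ((u : V →ₗ[K] V) - 1) b d = 1) := by
  intro d hd
  refine ⟨odd_case u b halt hinv d, fun hodd => ?_⟩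
  have h1 : eps K ((u : V →ₗ[K] V) - 1) b d = 1 := by
    by_contra hne
    obtain ⟨e, rfl⟩ : ∃ e, d = e + 1 := ⟨d - 1, by omega⟩
    apply Nat.not_even_iff_odd.2 hodd
    apply even_mult u b halt hnd hinv
    intro v hv
    by_contra hb
    apply hne
    unfold eps
    exact if_pos ⟨v, hv, hb⟩
  refine ⟨?_, h1⟩
  by_contra he
  rw [odd_case u b halt hinv d (Nat.not_even_iff_odd.1 he)] at h1
  exact zero_ne_one h1
end

section
/- Let (V,b) be a non-degenerate alternating bilinear K[u]-module on which u acts as a single Jordan block of size 2d (d ≥ 1). Then u² acts on V with exactly two Jordan blocks, both of size d; moreover, for the bilinear K[u²]-module (V,b): if d is even then ε_{V,b}(d) = 1 computed with respect to u², and if d is odd then ε_{V,b}(e) = 0 computed with respect to u² for all e ≥ 1 (i.e., (V,b) with u² is a paired module). -/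
open Module LinearMap

section helpers
variable {K : Type*} [Field K] {V : Type*} [AddCommGroup V] [Module K V]

theorem sq_rank_aux [FiniteDimensional K V] (X : V →ₗ[K] V) (n : ℕ)
    (hX : X ^ n = 0) (k : ℕ) (hk : X ^ k ≠ 0) :
    Module.finrank K (LinearMap.range (X ^ (k + 1))) <
      Module.finrank K (LinearMap.range (X ^ k)) := by
  have hle : LinearMap.range (X ^ (k + 1)) ≤ LinearMap.range (X ^ k) := by
    rintro _ ⟨v, rfl⟩
    exact ⟨X v, by rw [pow_succ]; rfl⟩
  apply Submodule.finrank_lt_finrank_of_lt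
  refine lt_of_le_of_ne hle ?_
  intro heq
  apply hk
  have key : ∀ m : ℕ, ∀ v, ∃ w, (X ^ k) v = (X ^ (k + m)) w := by
    intro m
    induction m with
    | zero => intro v; exact ⟨v, rfl⟩
    | succ m ih =>
      intro v
      obtain ⟨w, hw⟩ := ih v
      have : (X ^ k) w ∈ LinearMap.range (X ^ (k + 1)) := by rw [heq]; exact ⟨w, rfl⟩
      obtain ⟨z, hz⟩ := this
      refine ⟨z, ?_⟩
      rw [hw, show k + (m + 1) = m + (k + 1) by ring, pow_add X m (k + 1), Module.End.mul_apply,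
        hz, add_comm k m, pow_add, Module.End.mul_apply]
  ext v
  obtain ⟨w, hw⟩ := key n v
  rw [hw, pow_add, hX]; simp

theorem sq_rank [FiniteDimensional K V] (X : V →ₗ[K] V) (n : ℕ)
    (hdim : Module.finrank K V = n) (hX : X ^ n = 0) (hX' : X ^ (n - 1) ≠ 0) (k : ℕ) :
    Module.finrank K (LinearMap.range (X ^ k)) = n - k := by
  have hne : ∀ k, k < n → X ^ k ≠ 0 := by
    intro k hk h0
    apply hX'
    rw [show n - 1 = k + (n - 1 - k) by omega, pow_add, h0, zero_mul]
  have up : ∀ k, k ≤ n → Module.finrank K (LinearMap.range (X ^ k)) + k ≤ n := by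
    intro k
    induction k with
    | zero => 
      intro _
      have := Submodule.finrank_le (LinearMap.range (X ^ 0))
      omega
    | succ k ih =>
      intro hk
      have := ih (by omega)
      have := sq_rank_aux X n hX k (hne k (by omega))
      omega
  have dn : ∀ j, j ≤ n → j ≤ Module.finrank K (LinearMap.range (X ^ (n - j))) := by
    intro j
    induction j with
    | zero => intro _; omega
    | succ j ih =>
      intro hj
      have := ih (by omega)
      have h2 := sq_rank_aux X n hX (n - (j + 1)) (hne _ (by omega))
      rw [show n - (j + 1) + 1 = n - j by omega] at h2
      omega
  by_cases hk : k ≤ n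
  · have h1 := up k hk
    have h2 := dn (n - k) (by omega)
    rw [show n - (n - k) = k by omega] at h2
    omega
  · rw [show k = n + (k - n) by omega, pow_add, hX, zero_mul, LinearMap.range_zero, finrank_bot]
    omega

theorem sq_vanish (u : V ≃ₗ[K] V) (b : V →ₗ[K] V →ₗ[K] K)
    (hinv : ∀ v w, b (u v) (u w) = b v w) (X : V →ₗ[K] V) (hXu : X = (u : V →ₗ[K] V) - 1)
    (n : ℕ) (hX : X ^ n = 0) (v : V) :
    ∀ i j : ℕ, n ≤ i + j → ∀ w, b ((X ^ i) v) ((X ^ j) w) = 0 := by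
  have hXa : ∀ v, X v = u v - v := by intro v; rw [hXu]; rfl
  have adj : ∀ a c, b (X a) (u c) = - b a (X c) := by
    intro a c
    rw [hXa, hXa]; simp [hinv]
  have hc : ∀ j c, (X ^ j) (u c) = u ((X ^ j) c) := by
    intro j
    induction j with
    | zero => intro c; rfl
    | succ j ih => intro c; rw [pow_succ, Module.End.mul_apply, Module.End.mul_apply, ← ih, hXa, hXa]; simp
  intro i
  induction i with
  | zero =>
    intro j hj w
    rw [show j = n + (j - n) by omega, pow_add, hX]; simp
  | succ i ih =>
    intro j hj w
    obtain ⟨w', rfl⟩ := u.surjective w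
    rw [hc, pow_succ', Module.End.mul_apply, adj, ← Module.End.mul_apply, ← pow_succ',
      ih (j + 1) (by omega), neg_zero]

theorem sq_main [CharP K 2] (u : V ≃ₗ[K] V) (b : V →ₗ[K] V →ₗ[K] K)
    (halt : ∀ v, b v v = 0)
    (hinv : ∀ v w, b (u v) (u w) = b v w) (X : V →ₗ[K] V) (hXu : X = (u : V →ₗ[K] V) - 1)
    (m : ℕ) (hX : X ^ (2 * m + 2) = 0) (v : V) :
    (∀ w, b ((X ^ (2 * m + 1)) v) w = b v ((X ^ (2 * m + 1)) w)) ∧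
    b ((X ^ (2 * m)) v) v = (m : K) * b ((X ^ (2 * m + 1)) v) v := by
  have van := sq_vanish u b hinv X hXu _ hX v
  have hXa : ∀ v, X v = u v - v := by intro v; rw [hXu]; rfl
  have step : ∀ a c, b (X a) c = b a (X c) + b (X a) (X c) := by
    intro a c
    have h2 : (2 : K) = 0 := CharTwo.two_eq_zero
    rw [hXa, hXa]; simp [hinv]
    linear_combination (b (u a) c - b a c) * h2
  have step' : ∀ i j w, b ((X ^ (i + 1)) v) ((X ^ j) w) =
      b ((X ^ i) v) ((X ^ (j + 1)) w) + b ((X ^ (i + 1)) v) ((X ^ (j + 1)) w) := by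
    intro i j w
    rw [pow_succ', pow_succ', Module.End.mul_apply, Module.End.mul_apply]
    exact step _ _
  have top : ∀ j, j ≤ 2 * m + 1 → ∀ w,
      b ((X ^ (2 * m + 1 - j)) v) ((X ^ j) w) = b ((X ^ (2 * m + 1)) v) w := by
    intro j
    induction j with
    | zero => intro _ w; rfl
    | succ j ih =>
      intro hj w
      have h := step' (2 * m + 1 - (j + 1)) j w
      rw [van (2 * m + 1 - (j + 1) + 1) (j + 1) (by omega), add_zero,
        show 2 * m + 1 - (j + 1) + 1 = 2 * m + 1 - j by omega, ih (by omega)] at h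
      exact h.symm
  refine ⟨fun w => ?_, ?_⟩
  · have := top (2 * m + 1) le_rfl w
    rw [Nat.sub_self] at this
    exact this.symm
  · have mid : ∀ i, i ≤ m → b ((X ^ (m + i)) v) ((X ^ (m - i)) v) =
        (i : K) * b ((X ^ (2 * m + 1)) v) v := by
      intro i
      induction i with
      | zero => intro _; simp [halt]
      | succ i ih =>
        intro hi
        have h := step' (m + i) (m - (i + 1)) v
        rw [show m - (i + 1) + 1 = m - i by omega, ih (by omega)] at h
        have t := top (m - i) (by omega) v
        rw [show 2 * m + 1 - (m - i) = m + i + 1 by omega] at t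
        rw [t] at h
        rw [← add_assoc, h]; push_cast; ring
    have := mid m le_rfl
    rw [Nat.sub_self, ← two_mul] at this
    exact this

end helpers

/-- if `u` acts on the non-degenerate alternating bilinear `K[u]`-module
`(V,b)` as a single Jordan block of size `2d`, then `u²` has exactly two Jordan blocks, both of
size `d`; moreover w.r.t. `u²`, if `d` is even then `ε_{V,b}(d) = 1`, and if `d` is odd then
`ε_{V,b}(e) = 0` for all `e ≥ 1`. -/
theorem restriction_of_V2d_to_square
    (K : Type*) [Field K] [IsAlgClosed K] [CharP K 2]
    (V : Type*) [AddCommGroup V] [Module K V] [FiniteDimensional K V]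
    (u : V ≃ₗ[K] V) (huni : IsUnipotent K (u : V →ₗ[K] V))
    (hord : ∃ k : ℕ, u ^ (2 ^ k) = 1)
    (d : ℕ) (hd : 1 ≤ d)
    (hdim : Module.finrank K V = 2 * d)
    (hblock : jordanMult K ((u : V →ₗ[K] V) - 1) (2 * d) = 1)
    (b : V →ₗ[K] V →ₗ[K] K)
    (halt : ∀ v, b v v = 0)
    (hnd : ∀ v, (∀ w, b v w = 0) → v = 0)
    (hinv : ∀ v w, b (u v) (u w) = b v w) :
    jordanMult K ((u : V →ₗ[K] V) ^ 2 - 1) d = 2 ∧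
    (∀ e : ℕ, 1 ≤ e → e ≠ d → jordanMult K ((u : V →ₗ[K] V) ^ 2 - 1) e = 0) ∧
    (Even d → eps K ((u : V →ₗ[K] V) ^ 2 - 1) b d = 1) ∧
    (Odd d → ∀ e : ℕ, 1 ≤ e → eps K ((u : V →ₗ[K] V) ^ 2 - 1) b e = 0) := by
  obtain ⟨X, hXu⟩ : ∃ X : V →ₗ[K] V, X = (u : V →ₗ[K] V) - 1 := ⟨_, rfl⟩
  have hsq : (u : V →ₗ[K] V) ^ 2 - 1 = X ^ 2 := by
    have h2 : ∀ v : V, v + v = 0 := by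
      intro v
      rw [← two_smul K v, CharTwo.two_eq_zero, zero_smul]
    rw [hXu]
    ext v
    simp only [pow_two, LinearMap.sub_apply, Module.End.mul_apply, Module.End.one_apply, map_sub]
    have e1 := h2 (v - u v)
    have : ∀ a : V, (a - v) - (a - u v - (u v - v)) = -((v - u v) + (v - u v)) := by
      intro a; abel
    rw [← sub_eq_zero]
    exact (this _).trans (by rw [e1, neg_zero])
  rw [hsq]
  have hX : X ^ (2 * d) = 0 := by
    obtain ⟨N, hN⟩ := huni
    rw [← hXu] at hN
    rw [← hdim]
    have hc := LinearMap.aeval_self_charpoly X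
    rw [IsNilpotent.charpoly_eq_X_pow_finrank ⟨N, hN⟩] at hc
    simpa using hc
  have hX' : X ^ (2 * d - 1) ≠ 0 := by
    intro h
    rw [← hXu] at hblock
    unfold jordanMult at hblock
    rw [h, pow_succ, hX, zero_mul] at hblock
    rw [LinearMap.range_zero, finrank_bot] at hblock
    omega
  have rk := sq_rank X (2 * d) hdim hX hX'
  have rk2 : ∀ k, Module.finrank K (LinearMap.range ((X ^ 2) ^ k)) = 2 * d - 2 * k := by
    intro k
    rw [← pow_mul, rk]
  refine ⟨?_, ?_, ?_, ?_⟩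
  · unfold jordanMult
    rw [rk2, rk2, rk2]
    omega
  · intro e he hed
    unfold jordanMult
    rw [rk2, rk2, rk2]
    omega
  · intro hev
    obtain ⟨m, rfl⟩ : ∃ m, d = m + 1 := ⟨d - 1, by omega⟩
    unfold eps
    rw [if_pos]
    have hsing := rk (2 * m + 1)
    rw [show 2 * (m + 1) - (2 * m + 1) = 1 by omega] at hsing
    rw [show 2 * (m + 1) - 1 = 2 * m + 1 by omega] at hX'
    obtain ⟨v, hv⟩ : ∃ v, (X ^ (2 * m + 1)) v ≠ 0 := by
      by_contra! h
      exact hX' (LinearMap.ext h)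
    obtain ⟨w, hw⟩ : ∃ w, b ((X ^ (2 * m + 1)) v) w ≠ 0 := by
      by_contra! h
      exact hv (hnd _ h)
    have hm := sq_main u b halt hinv X hXu m hX v
    refine ⟨v, ?_, ?_⟩
    · rw [← pow_mul, hX]; rfl
    · rw [Nat.add_sub_cancel, ← pow_mul, hm.2]
      have hmK : (m : K) ≠ 0 := by
        rw [Ne, CharP.cast_eq_zero_iff K 2]
        intro h
        have := hev.two_dvd
        omega
      refine mul_ne_zero hmK ?_
      intro h0
      obtain ⟨c, hc⟩ := (finrank_eq_one_iff_of_nonzero' (⟨_, ⟨v, rfl⟩⟩ : LinearMap.range (X ^ (2 * m + 1)))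
        (by simpa [Subtype.ext_iff] using hv)).1 hsing ⟨_, ⟨w, rfl⟩⟩
      have hc' : c • (X ^ (2 * m + 1)) v = (X ^ (2 * m + 1)) w := congrArg Subtype.val hc
      apply hw
      rw [hm.1, ← hc', map_smul, ← hm.1, h0, smul_zero]
  · intro hodd e he
    unfold eps
    rw [if_neg]
    rintro ⟨v, hv, hne⟩
    apply hne
    rw [← pow_mul] at hv ⊢
    rcases lt_trichotomy e d with h | h | h
    · have hle : LinearMap.range (X ^ (2 * d - 2 * e)) ≤ LinearMap.ker (X ^ (2 * e)) := by
        rintro _ ⟨y, rfl⟩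
        rw [LinearMap.mem_ker, ← Module.End.mul_apply, ← pow_add,
          show 2 * e + (2 * d - 2 * e) = 2 * d by omega, hX]; rfl
      have heq := Submodule.eq_of_le_of_finrank_eq hle (by
        have := LinearMap.finrank_range_add_finrank_ker (X ^ (2 * e))
        rw [rk, hdim] at this
        rw [rk]; omega)
      have hmem : v ∈ LinearMap.ker (X ^ (2 * e)) := hv
      rw [← heq] at hmem
      obtain ⟨y, rfl⟩ := hmem
      rw [← Module.End.mul_apply, ← pow_add]
      exact sq_vanish u b hinv X hXu _ hX y _ _ (by omega) y
    · subst h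
      obtain ⟨m, rfl⟩ : ∃ m, e = m + 1 := ⟨e - 1, by omega⟩
      rw [Nat.add_sub_cancel, (sq_main u b halt hinv X hXu m hX v).2]
      have hmK : (m : K) = 0 := by
        rw [CharP.cast_eq_zero_iff K 2]
        obtain ⟨k, hk⟩ := hodd
        omega
      rw [hmK, zero_mul]
    · rw [show 2 * (e - 1) = 2 * d + (2 * (e - 1) - 2 * d) by omega, pow_add, hX]
      simp
end

section
/- Let m and n be odd positive integers and let u act on V_m ⊗ V_n as the tensor product of single unipotent Jordan blocks of sizes m and n over K. Then u has exactly one Jordan block of odd size on V_m ⊗ V_n, counted with multiplicity; that is, the sum over all odd d of the multiplicity of the Jordan block size d equals 1. -/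
set_option maxSynthPendingDepth 3

open Module LinearMap

open scoped TensorProduct

/-- `f` is a single nilpotent Jordan block of size `m`. -/
structure IsBlk {K : Type*} [Field K] {V : Type*} [AddCommGroup V] [Module K V]
    (f : V →ₗ[K] V) (m : ℕ) : Prop where
  pos : 1 ≤ m
  fin : FiniteDimensional K V
  dim : Module.finrank K V = m
  pow : f ^ m = 0
  ne : f ^ (m - 1) ≠ 0

lemma IsBlk.exists_basis {K : Type*} [Field K] {V : Type*} [AddCommGroup V] [Module K V]
    {f : V →ₗ[K] V} {m : ℕ} (h : IsBlk f m) :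
    ∃ (e : V) (b : Basis (Fin m) K V), ∀ i, b i = (f ^ (i : ℕ)) e := by
  obtain ⟨e, he⟩ : ∃ e, (f ^ (m - 1)) e ≠ 0 := by
    by_contra! hc
    exact h.ne (LinearMap.ext hc)
  have hz : ∀ k, m ≤ k → (f ^ k) e = 0 := by
    intro k hk
    obtain ⟨j, rfl⟩ := Nat.exists_eq_add_of_le' hk
    rw [pow_add, h.pow]; simp
  have li : LinearIndependent K (fun i : Fin m => (f ^ (i : ℕ)) e) := by
    rw [Fintype.linearIndependent_iff]
    intro c hc
    have key : ∀ i : ℕ, ∀ hi : i < m, c ⟨i, hi⟩ = 0 := by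
      intro i
      induction i using Nat.strong_induction_on with
      | _ i ih =>
        intro hi
        have h1 := congrArg (f ^ (m - 1 - i)) hc
        rw [map_sum, map_zero, Finset.sum_eq_single ⟨i, hi⟩] at h1
        · rw [map_smul, ← Module.End.mul_apply, ← pow_add] at h1
          have : m - 1 - i + i = m - 1 := by omega
          simp only [this] at h1
          exact (smul_eq_zero.mp h1).resolve_right he
        · intro j _ hj
          rw [map_smul, ← Module.End.mul_apply, ← pow_add]
          rcases lt_trichotomy (j : ℕ) i with hlt | heq | hgt
          · rw [ih j hlt j.2, zero_smul]
          · exact absurd (Fin.ext heq) hj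
          · rw [hz _ (by omega), smul_zero]
        · simp
    exact fun i => key i i.2
  have : Nonempty (Fin m) := ⟨⟨0, h.pos⟩⟩
  refine ⟨e, basisOfLinearIndependentOfCardEqFinrank li (by simp [h.dim]), fun i => by simp⟩

/-- Two blocks of the same size are conjugate. -/
lemma IsBlk.conj {K : Type*} [Field K] {V : Type*} [AddCommGroup V] [Module K V]
    {V' : Type*} [AddCommGroup V'] [Module K V']
    {f : V →ₗ[K] V} {f' : V' →ₗ[K] V'} {m : ℕ} (h : IsBlk f m) (h' : IsBlk f' m) :
    ∃ φ : V ≃ₗ[K] V', φ.toLinearMap ∘ₗ f = f' ∘ₗ φ.toLinearMap := by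
  obtain ⟨e, b, hb⟩ := h.exists_basis
  obtain ⟨e', b', hb'⟩ := h'.exists_basis
  have hφ : ∀ k, (b.equiv b' (Equiv.refl _)) ((f ^ k) e) = (f' ^ k) e' := by
    intro k
    by_cases hk : k < m
    · have := hb ⟨k, hk⟩
      simp only at this
      rw [← this, Basis.equiv_apply, Equiv.refl_apply, hb']
    · obtain ⟨j, rfl⟩ := Nat.exists_eq_add_of_le' (not_lt.mp hk)
      rw [pow_add, h.pow, pow_add, h'.pow]; simp
  refine ⟨b.equiv b' (Equiv.refl _), b.ext fun i => ?_⟩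
  simp only [LinearMap.comp_apply, LinearEquiv.coe_coe]
  rw [hb, hφ, ← Module.End.mul_apply, ← pow_succ', hφ, pow_succ', Module.End.mul_apply]

open Polynomial in
lemma exists_blk (K : Type*) [Field K] (m : ℕ) (hm : 1 ≤ m) :
    IsBlk (LinearMap.mulLeft K (AdjoinRoot.root (X ^ m : K[X]))) m := by
  have hmon : (X ^ m : K[X]).Monic := monic_X_pow m
  have := hmon.finite_adjoinRoot
  refine ⟨hm, this, ?_, ?_, ?_⟩
  · have := (AdjoinRoot.powerBasis' hmon).finrank
    simpa using this
  · rw [LinearMap.pow_mulLeft]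
    have : AdjoinRoot.root (X ^ m : K[X]) ^ m = 0 := by
      rw [AdjoinRoot.root, ← map_pow, AdjoinRoot.mk_self]
    rw [this]; simp
  · rw [LinearMap.pow_mulLeft]
    intro h0
    have h1 := congrArg (fun f => f 1) h0
    simp only [LinearMap.mulLeft_apply, mul_one, LinearMap.zero_apply] at h1
    rw [AdjoinRoot.root, ← map_pow, AdjoinRoot.mk_eq_zero] at h1
    have := Polynomial.natDegree_le_of_dvd h1 (by simp)
    simp at this
    omega

/-- The difference of the tensor product of unipotents and the identity. -/
noncomputable def ZZ {K : Type*} [Field K] {V : Type*} [AddCommGroup V] [Module K V]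
    {W : Type*} [AddCommGroup W] [Module K W] (f : V →ₗ[K] V) (g : W →ₗ[K] W) :
    (V ⊗[K] W) →ₗ[K] (V ⊗[K] W) := TensorProduct.map (1 + f) (1 + g) - 1

/-- rank of powers -/
noncomputable def rk {K : Type*} [Field K] {V : Type*} [AddCommGroup V] [Module K V]
    (f : V →ₗ[K] V) (k : ℕ) : ℕ := Module.finrank K (LinearMap.range (f ^ k))

lemma pow_intertwine {K : Type*} [Field K] {V : Type*} [AddCommGroup V] [Module K V]
    {W : Type*} [AddCommGroup W] [Module K W] (f : V →ₗ[K] V) (g : W →ₗ[K] W)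
    (φ : V →ₗ[K] W) (h : φ ∘ₗ f = g ∘ₗ φ) (k : ℕ) : φ ∘ₗ (f ^ k) = (g ^ k) ∘ₗ φ := by
  induction k with
  | zero => ext; simp
  | succ k ih =>
    rw [pow_succ, pow_succ, Module.End.mul_eq_comp, Module.End.mul_eq_comp, ← LinearMap.comp_assoc,
      ih, LinearMap.comp_assoc, h, LinearMap.comp_assoc]

lemma rank_sandwich {K : Type*} [Field K] {V : Type*} [AddCommGroup V] [Module K V]
    {W : Type*} [AddCommGroup W] [Module K W] (f : V →ₗ[K] V) (ι : V →ₗ[K] W) (π : W →ₗ[K] V)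
    (hι : Function.Injective ι) (hπ : Function.Surjective π) :
    Module.finrank K (LinearMap.range (ι ∘ₗ f ∘ₗ π)) = Module.finrank K (LinearMap.range f) := by
  rw [LinearMap.range_comp, LinearMap.range_comp_of_range_eq_top _ (LinearMap.range_eq_top.mpr hπ)]
  exact (Submodule.equivMapOfInjective ι hι _).finrank_eq.symm

lemma rk_conj {K : Type*} [Field K] {V : Type*} [AddCommGroup V] [Module K V]
    {W : Type*} [AddCommGroup W] [Module K W] (f : V →ₗ[K] V) (g : W →ₗ[K] W)
    (φ : V ≃ₗ[K] W) (h : φ.toLinearMap ∘ₗ f = g ∘ₗ φ.toLinearMap) (k : ℕ) : rk f k = rk g k := by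
  have h1 := pow_intertwine f g φ.toLinearMap h k
  have h2 : g ^ k = φ.toLinearMap ∘ₗ (f ^ k) ∘ₗ φ.symm.toLinearMap := by
    rw [← LinearMap.comp_assoc, h1, LinearMap.comp_assoc]; ext; simp
  unfold rk
  rw [h2, rank_sandwich _ _ _ φ.injective φ.symm.surjective]

lemma rk_comm {K : Type*} [Field K] {V : Type*} [AddCommGroup V] [Module K V]
    {W : Type*} [AddCommGroup W] [Module K W] (f : V →ₗ[K] V) (g : W →ₗ[K] W) (k : ℕ) :
    rk (ZZ f g) k = rk (ZZ g f) k := by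
  refine rk_conj _ _ (TensorProduct.comm K V W) ?_ k
  ext v w
  simp [ZZ]

lemma rk_congr_left {K : Type*} [Field K] {V : Type*} [AddCommGroup V] [Module K V]
    {V' : Type*} [AddCommGroup V'] [Module K V'] {W : Type*} [AddCommGroup W] [Module K W]
    {f : V →ₗ[K] V} {f' : V' →ₗ[K] V'} {m : ℕ} (h : IsBlk f m) (h' : IsBlk f' m)
    (g : W →ₗ[K] W) (k : ℕ) : rk (ZZ f g) k = rk (ZZ f' g) k := by
  obtain ⟨φ, hφ⟩ := h.conj h'
  have hφ' : ∀ v, φ (f v) = f' (φ v) := fun v => by simpa using LinearMap.congr_fun hφ v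
  refine rk_conj _ _ (TensorProduct.congr φ (LinearEquiv.refl K W)) ?_ k
  ext v w
  simp [ZZ, hφ']

lemma one_add_pow_char {K : Type*} [Field K] [CharP K 2] {A : Type*} [Ring A] [Algebra K A]
    (a : A) (t : ℕ) : (1 + a) ^ (2 ^ t) = 1 + a ^ (2 ^ t) := by
  have : Fact (Nat.Prime 2) := ⟨Nat.prime_two⟩
  have h : (1 + Polynomial.X : Polynomial K) ^ (2 ^ t) = 1 + Polynomial.X ^ (2 ^ t) := by
    rw [add_pow_char_pow, one_pow]
  have := congrArg (Polynomial.aeval a) h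
  simpa using this

lemma ker_bound {K : Type*} [Field K] {V : Type*} [AddCommGroup V] [Module K V]
    {W : Type*} [AddCommGroup W] [Module K W] [FiniteDimensional K W]
    {h : V →ₗ[K] V} {q : ℕ} (hh : IsBlk h q) (a : W →ₗ[K] W) :
    Module.finrank K (LinearMap.ker (TensorProduct.map h (1 : W →ₗ[K] W) -
      TensorProduct.map (1 : V →ₗ[K] V) a)) ≤ Module.finrank K W := by
  obtain ⟨e, b, hb⟩ := hh.exists_basis
  have := hh.fin
  let c : Fin q → (V ⊗[K] W →ₗ[K] W) := fun i =>
    (TensorProduct.lid K W).toLinearMap ∘ₗ TensorProduct.map (b.coord i) LinearMap.id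
  have hc : ∀ i v w, c i (v ⊗ₜ w) = b.repr v i • w := by
    intro i v w; simp [c]
  have hrec : ∀ w, w = ∑ i, b i ⊗ₜ[K] c i w := by
    intro w
    induction w using TensorProduct.induction_on with
    | zero => simp
    | add x y hx hy => 
      simp only [map_add, TensorProduct.tmul_add, Finset.sum_add_distrib]
      rw [← hx, ← hy]
    | tmul v w =>
      simp only [hc, TensorProduct.tmul_smul]
      conv_lhs => rw [← b.sum_repr v, TensorProduct.sum_tmul]
      rfl
  have hq := hh.pos
  have hstep : ∀ (i : ℕ) (hi : i + 1 < q) (w : V ⊗[K] W),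
      c ⟨i + 1, hi⟩ (TensorProduct.map h (1 : W →ₗ[K] W) w) = c ⟨i, by omega⟩ w := by
    intro i hi w
    have : c ⟨i + 1, hi⟩ ∘ₗ (TensorProduct.map h (1 : W →ₗ[K] W)) = c ⟨i, by omega⟩ := by
      refine TensorProduct.ext ?_
      refine b.ext fun j => ?_
      ext w
      change c _ (TensorProduct.map h (1 : W →ₗ[K] W) (b j ⊗ₜ[K] w)) = c _ (b j ⊗ₜ[K] w)
      rw [TensorProduct.map_tmul, hc, hc, Module.End.one_apply]
      rw [hb j, ← Module.End.mul_apply, ← pow_succ', ← hb j]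
      by_cases hj : (j : ℕ) + 1 < q
      · have := hb ⟨j + 1, hj⟩
        simp only at this
        rw [← this]
        simp [Finsupp.single_apply, Fin.ext_iff]
      · have hjq : (j : ℕ) + 1 = q := by omega
        rw [hjq, hh.pow]
        have : j ≠ ⟨i, by omega⟩ := by
          intro hji
          have := congrArg Fin.val hji
          simp only at this
          omega
        simp [this]
    exact LinearMap.congr_fun this w
  have ha : ∀ i w, c i (TensorProduct.map (1 : V →ₗ[K] V) a w) = a (c i w) := by
    intro i w
    have : c i ∘ₗ (TensorProduct.map (1 : V →ₗ[K] V) a) = a ∘ₗ c i := by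
      ext v w; simp [hc]
    exact LinearMap.congr_fun this w
  refine LinearMap.finrank_le_finrank_of_injective
    (f := c ⟨q - 1, by omega⟩ ∘ₗ (LinearMap.ker _).subtype) ?_
  rw [← LinearMap.ker_eq_bot, LinearMap.ker_eq_bot']
  rintro ⟨w, hw⟩ h0
  simp only [LinearMap.comp_apply, Submodule.subtype_apply] at h0
  rw [LinearMap.mem_ker, LinearMap.sub_apply, sub_eq_zero] at hw
  have hall : ∀ j i, ∀ hi : i < q, i + j = q - 1 → c ⟨i, hi⟩ w = 0 := by
    intro j
    induction j with
    | zero => intro i hi hij; obtain rfl : i = q - 1 := by omega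
              exact h0
    | succ j ih =>
      intro i hi hij
      rw [← hstep i (by omega), hw, ha, ih (i + 1) (by omega) (by omega), map_zero]
  refine Subtype.ext ?_
  change w = 0
  rw [hrec w]
  refine Finset.sum_eq_zero fun i _ => ?_
  rw [hall (q - 1 - i) i i.2 (by omega), TensorProduct.tmul_zero]

lemma finrank_ker_comp_le' {K : Type*} [Field K] {F : Type*} [AddCommGroup F] [Module K F]
    [FiniteDimensional K F] (f g : F →ₗ[K] F) :
    Module.finrank K (LinearMap.ker (g ∘ₗ f)) ≤
      Module.finrank K (LinearMap.ker f) + Module.finrank K (LinearMap.ker g) := by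
  have h := LinearMap.finrank_range_add_finrank_ker (f.domRestrict (LinearMap.ker (g ∘ₗ f)))
  have h1 : Module.finrank K (LinearMap.range (f.domRestrict (LinearMap.ker (g ∘ₗ f)))) ≤
      Module.finrank K (LinearMap.ker g) := by
    refine Submodule.finrank_mono ?_
    rintro _ ⟨⟨v, hv⟩, rfl⟩
    simpa using hv
  have h2 : Module.finrank K (LinearMap.ker (f.domRestrict (LinearMap.ker (g ∘ₗ f)))) ≤
      Module.finrank K (LinearMap.ker f) := by
    rw [← Submodule.finrank_map_subtype_eq]
    refine Submodule.finrank_mono ?_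
    rintro _ ⟨⟨v, hv⟩, hv', rfl⟩
    simpa using hv'
  omega

lemma finrank_range_comp_add {K : Type*} [Field K] {F : Type*} [AddCommGroup F] [Module K F]
    [FiniteDimensional K F] (f g : F →ₗ[K] F) :
    Module.finrank K (LinearMap.range (g * f)) +
      Module.finrank K (LinearMap.ker g ⊓ LinearMap.range f : Submodule K F) =
      Module.finrank K (LinearMap.range f) := by
  have h := LinearMap.finrank_range_add_finrank_ker (g.domRestrict (LinearMap.range f))
  have h1 : LinearMap.range (g.domRestrict (LinearMap.range f)) = LinearMap.range (g * f) := by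
    ext v; simp
  have h2 : Module.finrank K (LinearMap.ker (g.domRestrict (LinearMap.range f))) =
      Module.finrank K (LinearMap.ker g ⊓ LinearMap.range f : Submodule K F) := by
    rw [← Submodule.finrank_map_subtype_eq]
    have : Submodule.map (LinearMap.range f).subtype
        (LinearMap.ker (g.domRestrict (LinearMap.range f))) =
        LinearMap.ker g ⊓ LinearMap.range f := by
      ext v
      simp only [Submodule.mem_map, Submodule.mem_inf, LinearMap.mem_ker]
      constructor
      · rintro ⟨⟨w, hw⟩, h, rfl⟩
        exact ⟨by simpa using h, hw⟩
      · rintro ⟨h, hw⟩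
        exact ⟨⟨v, hw⟩, by simpa using h, rfl⟩
    rw [this]
  rw [h1, h2] at h
  exact h

/-- `F` is free of rank `n` over `K[Z]/(Z^q)` -/
structure IsFr {K : Type*} [Field K] {F : Type*} [AddCommGroup F] [Module K F]
    (Z : F →ₗ[K] F) (q n : ℕ) : Prop where
  dim : Module.finrank K F = q * n
  pow : Z ^ q = 0
  ker : Module.finrank K (LinearMap.ker Z) ≤ n

lemma IsFr.ker_le {K : Type*} [Field K] {F : Type*} [AddCommGroup F] [Module K F]
    [FiniteDimensional K F] {Z : F →ₗ[K] F} {q n : ℕ} (h : IsFr Z q n) (i : ℕ) :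
    Module.finrank K (LinearMap.ker (Z ^ i)) ≤ i * n := by
  induction i with
  | zero => simp [Module.End.one_eq_id]
  | succ i ih =>
    have := finrank_ker_comp_le' (Z ^ i) Z
    rw [← Module.End.mul_eq_comp, ← pow_succ'] at this
    have := h.ker
    rw [add_mul]; omega

lemma IsFr.ker_eq {K : Type*} [Field K] {F : Type*} [AddCommGroup F] [Module K F]
    [FiniteDimensional K F] {Z : F →ₗ[K] F} {q n : ℕ} (h : IsFr Z q n) (i : ℕ) (hi : i ≤ q) :
    Module.finrank K (LinearMap.ker (Z ^ i)) = i * n := by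
  have h1 := h.ker_le i
  have h2 := h.ker_le (q - i)
  have h3 := finrank_ker_comp_le' (Z ^ i) (Z ^ (q - i))
  rw [← Module.End.mul_eq_comp, ← pow_add, Nat.sub_add_cancel hi, h.pow, LinearMap.ker_zero,
    finrank_top, h.dim] at h3
  have h4 : q * n = (q - i) * n + i * n := by rw [← add_mul, Nat.sub_add_cancel hi]
  omega

lemma IsFr.range_eq {K : Type*} [Field K] {F : Type*} [AddCommGroup F] [Module K F]
    [FiniteDimensional K F] {Z : F →ₗ[K] F} {q n : ℕ} (h : IsFr Z q n) (i : ℕ) (hi : i ≤ q) :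
    LinearMap.range (Z ^ (q - i)) = LinearMap.ker (Z ^ i) := by
  have h1 := h.ker_eq (q - i) (by omega)
  have h2 := h.ker_eq i hi
  have h3 := LinearMap.finrank_range_add_finrank_ker (Z ^ (q - i))
  rw [h.dim] at h3
  have h4 : q * n = (q - i) * n + i * n := by rw [← add_mul, Nat.sub_add_cancel hi]
  refine Submodule.eq_of_le_of_finrank_eq ?_ (by omega)
  rintro _ ⟨v, rfl⟩
  rw [LinearMap.mem_ker, ← Module.End.mul_apply, ← pow_add, Nat.add_sub_cancel' hi, h.pow,
    LinearMap.zero_apply]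

lemma swap_rank {K : Type*} [Field K] {F : Type*} [AddCommGroup F] [Module K F]
    [FiniteDimensional K F] {x z : F →ₗ[K] F} {q n : ℕ} (hx : IsFr x q n) (hz : IsFr z q n)
    (hc : Commute x z) (m k : ℕ) (hm : m ≤ q) (hk : k ≤ q) :
    Module.finrank K (LinearMap.range (z ^ k * x ^ (q - m))) + k * n =
      m * n + Module.finrank K (LinearMap.range (z ^ (q - k) * x ^ m)) := by
  have h1 := finrank_range_comp_add (x ^ (q - m)) (z ^ k)
  have h2 := finrank_range_comp_add (z ^ (q - k)) (x ^ m)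
  rw [hx.range_eq m hm, hx.ker_eq m hm] at h1
  rw [hz.range_eq k hk, hz.ker_eq k hk, inf_comm, (hc.pow_pow m (q - k)).eq] at h2
  omega

lemma rank_model {K : Type*} [Field K] {V : Type*} [AddCommGroup V] [Module K V]
    {V' : Type*} [AddCommGroup V'] [Module K V'] {W : Type*} [AddCommGroup W] [Module K W]
    {h : V →ₗ[K] V} {f : V' →ₗ[K] V'} {q m j : ℕ} (hh : IsBlk h q) (hf : IsBlk f m)
    (hq : m + j = q) (g : W →ₗ[K] W) (k : ℕ) :
    Module.finrank K (LinearMap.range (ZZ h g ^ k * (TensorProduct.map h (1 : W →ₗ[K] W)) ^ j)) =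
      rk (ZZ f g) k := by
  obtain ⟨e, b, hb⟩ := hh.exists_basis
  obtain ⟨e', c, hc⟩ := hf.exists_basis
  let π : V →ₗ[K] V' := b.constr K (fun i => (f ^ (i : ℕ)) e')
  let ι : V' →ₗ[K] V := c.constr K (fun i => (h ^ ((i : ℕ) + j)) e)
  have hπ : ∀ k, π ((h ^ k) e) = (f ^ k) e' := by
    intro k
    by_cases hk : k < q
    · have := hb ⟨k, hk⟩
      simp only at this
      rw [← this, Basis.constr_basis]
    · obtain ⟨l, rfl⟩ := Nat.exists_eq_add_of_le' (not_lt.mp hk)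
      rw [pow_add, hh.pow, ← hq, ← add_assoc, add_right_comm, pow_add, hf.pow]; simp
  have hι : ∀ k, ι ((f ^ k) e') = (h ^ (k + j)) e := by
    intro k
    by_cases hk : k < m
    · have := hc ⟨k, hk⟩
      simp only at this
      rw [← this, Basis.constr_basis]
    · obtain ⟨l, rfl⟩ := Nat.exists_eq_add_of_le' (not_lt.mp hk)
      rw [pow_add, hf.pow, add_assoc, hq, pow_add, hh.pow]; simp
  have hιf : ∀ v, ι (f v) = h (ι v) := by
    intro v
    have : ι ∘ₗ f = h ∘ₗ ι := by
      refine c.ext fun i => ?_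
      simp only [LinearMap.comp_apply]
      rw [hc, hι, ← Module.End.mul_apply, ← pow_succ', hι, ← Module.End.mul_apply, ← pow_succ']
      congr 2; omega
    exact LinearMap.congr_fun this v
  have hιπ : ι ∘ₗ π = h ^ j := by
    refine b.ext fun i => ?_
    simp only [LinearMap.comp_apply]
    rw [hb, hπ, hι, add_comm, pow_add, Module.End.mul_apply]
  have hsurj : Function.Surjective π := by
    rw [← LinearMap.range_eq_top, eq_top_iff, ← c.span_eq, Submodule.span_le]
    rintro _ ⟨i, rfl⟩
    exact ⟨(h ^ (i : ℕ)) e, by rw [hπ, hc]⟩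
  have hinj : Function.Injective ι := by
    have hli : LinearIndependent K (fun i : Fin m => b ⟨(i : ℕ) + j, by omega⟩) :=
      b.linearIndependent.comp (fun i : Fin m => (⟨(i : ℕ) + j, by omega⟩ : Fin q))
        (fun a a' h => by simp [Fin.ext_iff] at h; exact Fin.ext h)
    rw [← LinearMap.ker_eq_bot, LinearMap.ker_eq_bot']
    intro v hv
    rw [Fintype.linearIndependent_iff] at hli
    have h0 := hli (fun i => c.repr v i) (by
      rw [← hv]
      conv_rhs => rw [← c.sum_repr v, map_sum]
      refine Finset.sum_congr rfl fun i _ => ?_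
      rw [map_smul, hc, hι, hb])
    rw [← c.sum_repr v]
    exact Finset.sum_eq_zero fun i _ => by rw [h0 i, zero_smul]
  have e1 : (TensorProduct.map h (1 : W →ₗ[K] W)) ^ j = (ι.rTensor W) ∘ₗ (π.rTensor W) := by
    rw [← LinearMap.rTensor_comp, hιπ, TensorProduct.map_pow, one_pow]; rfl
  have e2 : (ι.rTensor W) ∘ₗ (ZZ f g) = (ZZ h g) ∘ₗ (ι.rTensor W) := by
    ext v w
    simp [ZZ, hιf]
  have e3 := pow_intertwine _ _ _ e2 k
  rw [e1, Module.End.mul_eq_comp, ← LinearMap.comp_assoc, ← e3, LinearMap.comp_assoc,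
    rank_sandwich _ _ _ (Module.Flat.rTensor_preserves_injective_linearMap ι hinj)
      (LinearMap.rTensor_surjective W hsurj)]
  rfl

lemma ZZ_pow {K : Type*} [Field K] [CharP K 2] {V : Type*} [AddCommGroup V] [Module K V]
    {W : Type*} [AddCommGroup W] [Module K W] {f : V →ₗ[K] V} {g : W →ₗ[K] W} (t : ℕ)
    (hf : f ^ (2 ^ t) = 0) (hg : g ^ (2 ^ t) = 0) : ZZ f g ^ (2 ^ t) = 0 := by
  have h := one_add_pow_char (K := K) (ZZ f g) t
  have h1 : 1 + ZZ f g = TensorProduct.map (1 + f) (1 + g) := by simp [ZZ]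
  rw [h1, TensorProduct.map_pow, one_add_pow_char (K := K), one_add_pow_char (K := K), hf, hg,
    add_zero, add_zero, TensorProduct.map_one] at h
  simpa using h.symm

lemma reflect {K : Type*} [Field K] [CharP K 2] {V : Type*} [AddCommGroup V] [Module K V]
    {V' : Type*} [AddCommGroup V'] [Module K V'] {W : Type*} [AddCommGroup W] [Module K W]
    [FiniteDimensional K W]
    {f : V →ₗ[K] V} {f' : V' →ₗ[K] V'} {m m' t : ℕ} (hf : IsBlk f m) (hf' : IsBlk f' m')
    (hq : m + m' = 2 ^ t) {g : W →ₗ[K] W} (hg : g ^ (2 ^ t) = 0) (k : ℕ) (hk : k ≤ 2 ^ t) :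
    rk (ZZ f g) k + k * Module.finrank K W =
      m * Module.finrank K W + rk (ZZ f' g) (2 ^ t - k) := by
  obtain ⟨q, hqq⟩ : ∃ q, q = 2 ^ t := ⟨_, rfl⟩
  have hq1 : 1 ≤ 2 ^ t := Nat.one_le_two_pow
  have hh := exists_blk K (2 ^ t) hq1
  set h := LinearMap.mulLeft K (AdjoinRoot.root (Polynomial.X ^ (2 ^ t) : Polynomial K)) with hdef
  have := hh.fin
  have hdim : Module.finrank K (AdjoinRoot (Polynomial.X ^ (2 ^ t) : Polynomial K) ⊗[K] W) =
      2 ^ t * Module.finrank K W := by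
    rw [Module.finrank_tensorProduct, hh.dim]
  have hx : IsFr (TensorProduct.map h (1 : W →ₗ[K] W)) (2 ^ t) (Module.finrank K W) := by
    refine ⟨hdim, ?_, ?_⟩
    · rw [TensorProduct.map_pow, hh.pow, TensorProduct.map_zero_left]
    · have := ker_bound hh (0 : W →ₗ[K] W)
      rwa [TensorProduct.map_zero_right, sub_zero] at this
  have hz : IsFr (ZZ h g) (2 ^ t) (Module.finrank K W) := by
    refine ⟨hdim, ZZ_pow t hh.pow hg, ?_⟩
    have hc : (1 + g) ^ (2 ^ t - 1) * (1 + g) = 1 := by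
      rw [← pow_succ, Nat.sub_add_cancel hq1, one_add_pow_char (K := K), hg, add_zero]
    set c := (1 + g) ^ (2 ^ t - 1) with hcdef
    refine le_trans (Submodule.finrank_mono ?_) (ker_bound hh (c - 1))
    intro w hw
    rw [LinearMap.mem_ker, ZZ, LinearMap.sub_apply, sub_eq_zero] at hw
    have h1 := congrArg (TensorProduct.map
      (1 : Module.End K (AdjoinRoot (Polynomial.X ^ (2 ^ t) : Polynomial K))) c) hw
    rw [← Module.End.mul_apply, ← TensorProduct.map_mul, hc, one_mul, TensorProduct.map_add_left,
      TensorProduct.map_one, LinearMap.add_apply] at h1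
    have h2 : TensorProduct.map
        (1 : Module.End K (AdjoinRoot (Polynomial.X ^ (2 ^ t) : Polynomial K))) c =
        TensorProduct.map 1 (c - 1) + 1 := by
      rw [← TensorProduct.map_one, ← TensorProduct.map_add_right, sub_add_cancel]
    rw [h2, LinearMap.add_apply, add_comm] at h1
    rw [LinearMap.mem_ker, LinearMap.sub_apply, sub_eq_zero]
    exact add_right_cancel h1
  have hcomm : Commute (TensorProduct.map h (1 : W →ₗ[K] W)) (ZZ h g) := by
    refine Commute.sub_right ?_ (Commute.one_right _)
    change _ * _ = _ * _
    rw [← TensorProduct.map_mul, ← TensorProduct.map_mul, one_mul, mul_one, mul_add, add_mul,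
      mul_one, one_mul]
  have key := swap_rank hx hz hcomm m k (by omega) hk
  rw [rank_model hh hf (by omega : m + (2 ^ t - m) = 2 ^ t), 
    rank_model hh hf' (by omega : m' + m = 2 ^ t)] at key
  exact key

/-- The sum of the multiplicities of odd sizes below `B`. -/
noncomputable def oddSum {K : Type*} [Field K] {V : Type*} [AddCommGroup V] [Module K V]
    (f : V →ₗ[K] V) (B : ℕ) : ℕ :=
  ∑ d ∈ (Finset.range B).filter (fun d => Odd d), jordanMult K f d

lemma jm_eq {K : Type*} [Field K] {V : Type*} [AddCommGroup V] [Module K V]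
    (f : V →ₗ[K] V) (d : ℕ) :
    jordanMult K f d = rk f (d - 1) + rk f (d + 1) - 2 * rk f d := rfl

lemma oddSum_congr {K : Type*} [Field K] {V : Type*} [AddCommGroup V] [Module K V]
    {W : Type*} [AddCommGroup W] [Module K W] {f : V →ₗ[K] V} {g : W →ₗ[K] W}
    (h : ∀ k, rk f k = rk g k) {B : ℕ} : oddSum f B = oddSum g B := by
  unfold oddSum
  refine Finset.sum_congr rfl fun d _ => ?_
  rw [jm_eq, jm_eq, h, h, h]

lemma rk_zero_of {K : Type*} [Field K] {V : Type*} [AddCommGroup V] [Module K V]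
    {f : V →ₗ[K] V} {q k : ℕ} (hf : f ^ q = 0) (hk : q ≤ k) : rk f k = 0 := by
  rw [rk, pow_eq_zero_of_le hk hf, LinearMap.range_zero, finrank_bot]

lemma oddSum_extend {K : Type*} [Field K] {V : Type*} [AddCommGroup V] [Module K V]
    (f : V →ₗ[K] V) (B C : ℕ) (hf : f ^ (C - 1) = 0) (hBC : C ≤ B) :
    oddSum f B = oddSum f C := by
  unfold oddSum
  symm
  refine Finset.sum_subset ?_ ?_
  · intro d
    simp only [Finset.mem_filter, Finset.mem_range]
    exact fun h => ⟨by omega, h.2⟩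
  · intro d hd hd'
    simp only [Finset.mem_filter, Finset.mem_range, not_and] at hd hd'
    have : C ≤ d := by
      by_contra hc
      exact hd' (by omega) hd.2
    rw [jm_eq, rk_zero_of hf (by omega : C - 1 ≤ d - 1), rk_zero_of hf (by omega : C - 1 ≤ d + 1)]
    omega

lemma oddSum_reflect {K : Type*} [Field K] [CharP K 2] {V : Type*} [AddCommGroup V] [Module K V]
    {V' : Type*} [AddCommGroup V'] [Module K V'] {W : Type*} [AddCommGroup W] [Module K W]
    [FiniteDimensional K W]
    {f : V →ₗ[K] V} {f' : V' →ₗ[K] V'} {m m' t : ℕ} (hf : IsBlk f m) (hf' : IsBlk f' m')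
    (hq : m + m' = 2 ^ (t + 1)) {g : W →ₗ[K] W} (hg : g ^ (2 ^ (t + 1)) = 0) :
    oddSum (ZZ f g) (2 ^ (t + 1) + 1) = oddSum (ZZ f' g) (2 ^ (t + 1) + 1) := by
  have key := reflect hf hf' hq hg
  have hev : Even (2 ^ (t + 1)) := ⟨2 ^ t, by rw [pow_succ]; omega⟩
  have hodd : ∀ d, Odd d → d < 2 ^ (t + 1) + 1 → 1 ≤ d ∧ d + 1 ≤ 2 ^ (t + 1) := by
    intro d hd hlt
    obtain ⟨a, rfl⟩ := hd
    obtain ⟨b, hb⟩ := hev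
    omega
  unfold oddSum
  refine Finset.sum_bij' (fun d _ => 2 ^ (t + 1) - d) (fun d _ => 2 ^ (t + 1) - d) ?_ ?_ ?_ ?_ ?_
  · intro d hd
    simp only [Finset.mem_filter, Finset.mem_range] at hd ⊢
    obtain ⟨h1, h2⟩ := hodd d hd.2 hd.1
    exact ⟨by omega, Nat.Even.sub_odd (by omega) hev hd.2⟩
  · intro d hd
    simp only [Finset.mem_filter, Finset.mem_range] at hd ⊢
    obtain ⟨h1, h2⟩ := hodd d hd.2 hd.1
    exact ⟨by omega, Nat.Even.sub_odd (by omega) hev hd.2⟩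
  · intro d hd
    simp only [Finset.mem_filter, Finset.mem_range] at hd
    omega
  · intro d hd
    simp only [Finset.mem_filter, Finset.mem_range] at hd
    omega
  · intro d hd
    simp only [Finset.mem_filter, Finset.mem_range] at hd
    obtain ⟨h1, h2⟩ := hodd d hd.2 hd.1
    obtain ⟨c, rfl⟩ : ∃ c, d = c + 1 := ⟨d - 1, by omega⟩
    have k1 := key c (by omega)
    have k2 := key (c + 1) (by omega)
    have k3 := key (c + 1 + 1) (by omega)
    rw [jm_eq, jm_eq]
    have e1 : 2 ^ (t + 1) - (c + 1) - 1 = 2 ^ (t + 1) - (c + 1 + 1) := by omega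
    have e2 : 2 ^ (t + 1) - (c + 1) + 1 = 2 ^ (t + 1) - c := by omega
    rw [e1, e2, Nat.add_sub_cancel]
    simp only [add_mul] at k1 k2 k3
    omega

/-- The model block. -/
noncomputable def blk (K : Type*) [Field K] (m : ℕ) :
    AdjoinRoot (Polynomial.X ^ m : Polynomial K) →ₗ[K]
      AdjoinRoot (Polynomial.X ^ m : Polynomial K) :=
  LinearMap.mulLeft K (AdjoinRoot.root (Polynomial.X ^ m : Polynomial K))

lemma blk_isBlk (K : Type*) [Field K] (m : ℕ) (hm : 1 ≤ m) : IsBlk (blk K m) m :=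
  exists_blk K m hm

lemma main_models (K : Type*) [Field K] [CharP K 2] (t : ℕ) :
    ∀ m n : ℕ, 1 ≤ m → 1 ≤ n → Odd m → Odd n → m ≤ 2 ^ t → n ≤ 2 ^ t →
      ∀ B, 2 ^ t + 1 ≤ B → oddSum (ZZ (blk K m) (blk K n)) B = 1 := by
  have hB : ∀ t m n, 1 ≤ m → 1 ≤ n → m ≤ 2 ^ t → n ≤ 2 ^ t → ∀ B, 2 ^ t + 1 ≤ B →
      oddSum (ZZ (blk K m) (blk K n)) B = oddSum (ZZ (blk K m) (blk K n)) (2 ^ t + 1) := by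
    intro t m n hm hn hmt hnt B hB
    refine oddSum_extend _ _ _ ?_ hB
    rw [Nat.add_sub_cancel]
    exact ZZ_pow t (pow_eq_zero_of_le hmt (blk_isBlk K m hm).pow)
      (pow_eq_zero_of_le hnt (blk_isBlk K n hn).pow)
  induction t with
  | zero =>
    intro m n hm hn _ _ hm1 hn1 B hBB
    rw [hB 0 m n hm hn hm1 hn1 B hBB]
    obtain rfl : m = 1 := by simp at hm1; omega
    obtain rfl : n = 1 := by simp at hn1; omega
    have b := blk_isBlk K 1 le_rfl
    have := b.fin
    have hs : (Finset.range (2 ^ 0 + 1)).filter (fun d => Odd d) = {1} := by decide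
    rw [oddSum, hs, Finset.sum_singleton, jm_eq]
    have hz : ZZ (blk K 1) (blk K 1) ^ 1 = 0 := ZZ_pow 0 b.pow b.pow
    rw [rk_zero_of hz (by omega : 1 ≤ 1 + 1), rk_zero_of hz le_rfl, rk, Nat.sub_self, pow_zero,
      Module.End.one_eq_id, LinearMap.range_id, finrank_top, Module.finrank_tensorProduct, b.dim]
  | succ t ih =>
    have hpow : 2 ^ (t + 1) = 2 ^ t + 2 ^ t := by rw [pow_succ]; omega
    have step1 : ∀ m n : ℕ, 1 ≤ m → 1 ≤ n → Odd m → Odd n → m ≤ 2 ^ (t + 1) → n ≤ 2 ^ t →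
        oddSum (ZZ (blk K m) (blk K n)) (2 ^ (t + 1) + 1) = 1 := by
      intro m n hm hn hmo hno hmt hnt
      by_cases hmt' : m ≤ 2 ^ t
      · exact ih m n hm hn hmo hno hmt' hnt _ (by omega)
      · have hlt : m < 2 ^ (t + 1) := by
          obtain ⟨a, rfl⟩ := hmo
          omega
        have bn := blk_isBlk K n hn
        have := bn.fin
        rw [oddSum_reflect (t := t) (blk_isBlk K m hm) (blk_isBlk K (2 ^ (t + 1) - m) (by omega))
          (by omega) (pow_eq_zero_of_le (by omega) bn.pow)]
        exact ih _ n (by omega) hn (Nat.Even.sub_odd hmt ⟨2 ^ t, hpow⟩ hmo) hno (by omega) hnt _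
          (by omega)
    intro m n hm hn hmo hno hmt hnt B hBB
    rw [hB (t + 1) m n hm hn hmt hnt B hBB]
    by_cases hnt' : n ≤ 2 ^ t
    · exact step1 m n hm hn hmo hno hmt hnt'
    · have hlt : n < 2 ^ (t + 1) := by
        obtain ⟨a, rfl⟩ := hno
        omega
      have bm := blk_isBlk K m hm
      have := bm.fin
      rw [oddSum_congr (rk_comm _ _), oddSum_reflect (blk_isBlk K n hn)
        (blk_isBlk K (2 ^ (t + 1) - n) (by omega))
          (by omega) (pow_eq_zero_of_le hmt bm.pow), oddSum_congr (rk_comm _ _)]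
      exact step1 m _ hm (by omega) hmo (Nat.Even.sub_odd hnt ⟨2 ^ t, hpow⟩ hno) hmt (by omega)

open TensorProduct in
/-- the tensor product of single unipotent Jordan blocks of odd sizes `m`, `n`
over a field of characteristic 2 has exactly one Jordan block of odd size, counted with
multiplicity. -/
theorem tensor_of_odd_blocks_unique_odd_block
    (K : Type*) [Field K] [IsAlgClosed K] [CharP K 2]
    (V₁ : Type*) [AddCommGroup V₁] [Module K V₁] [FiniteDimensional K V₁]
    (V₂ : Type*) [AddCommGroup V₂] [Module K V₂] [FiniteDimensional K V₂]
    (m n : ℕ) (hm : 1 ≤ m) (hn : 1 ≤ n) (hmodd : Odd m) (hnodd : Odd n)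
    (u₁ : V₁ ≃ₗ[K] V₁) (u₂ : V₂ ≃ₗ[K] V₂)
    (hdim₁ : Module.finrank K V₁ = m) (hdim₂ : Module.finrank K V₂ = n)
    (hb₁ : ((u₁ : V₁ →ₗ[K] V₁) - 1) ^ (m - 1) ≠ 0)
    (hb₁' : ((u₁ : V₁ →ₗ[K] V₁) - 1) ^ m = 0)
    (hb₂ : ((u₂ : V₂ →ₗ[K] V₂) - 1) ^ (n - 1) ≠ 0)
    (hb₂' : ((u₂ : V₂ →ₗ[K] V₂) - 1) ^ n = 0) :
    ∑ d ∈ (Finset.range (m * n + 1)).filter (fun d => Odd d),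
      jordanMult K ((TensorProduct.congr u₁ u₂).toLinearMap - 1) d = 1 := by
  have B₁ : IsBlk ((u₁ : V₁ →ₗ[K] V₁) - 1) m := ⟨hm, inferInstance, hdim₁, hb₁', hb₁⟩
  have B₂ : IsBlk ((u₂ : V₂ →ₗ[K] V₂) - 1) n := ⟨hn, inferInstance, hdim₂, hb₂', hb₂⟩
  have hZ : (TensorProduct.congr u₁ u₂).toLinearMap - 1 =
      ZZ ((u₁ : V₁ →ₗ[K] V₁) - 1) ((u₂ : V₂ →ₗ[K] V₂) - 1) := by
    simp only [ZZ, add_sub_cancel]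
    rfl
  rw [hZ]
  have hrk : ∀ k, rk (ZZ ((u₁ : V₁ →ₗ[K] V₁) - 1) ((u₂ : V₂ →ₗ[K] V₂) - 1)) k =
      rk (ZZ (blk K m) (blk K n)) k := by
    intro k
    rw [rk_congr_left B₁ (blk_isBlk K m hm), rk_comm, rk_congr_left B₂ (blk_isBlk K n hn),
      rk_comm]
  have h1 := main_models K (m + n) m n hm hn hmodd hnodd
    ((Nat.lt_two_pow_self).le.trans (Nat.pow_le_pow_right (by norm_num) (by omega)))
    ((Nat.lt_two_pow_self).le.trans (Nat.pow_le_pow_right (by norm_num) (by omega)))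
    (2 ^ (m + n) + 1 + (m * n + 1)) (by omega)
  rw [← oddSum_congr hrk] at h1
  refine Eq.trans (oddSum_extend _ _ (m * n + 1) ?_ (Nat.le_add_left _ _)).symm h1
  -- nilpotency
  have hnil : (ZZ ((u₁ : V₁ →ₗ[K] V₁) - 1) ((u₂ : V₂ →ₗ[K] V₂) - 1)) ^ (2 ^ (m + n)) = 0 := by
    refine ZZ_pow _ ?_ ?_
    · exact pow_eq_zero_of_le ((Nat.lt_two_pow_self).le.trans
        (Nat.pow_le_pow_right (by norm_num) (by omega))) hb₁'
    · exact pow_eq_zero_of_le ((Nat.lt_two_pow_self).le.trans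
        (Nat.pow_le_pow_right (by norm_num) (by omega))) hb₂'
  have hle := Module.End.ker_pow_le_ker_pow_finrank
    (ZZ ((u₁ : V₁ →ₗ[K] V₁) - 1) ((u₂ : V₂ →ₗ[K] V₂) - 1)) (2 ^ (m + n))
  rw [hnil, LinearMap.ker_zero, Module.finrank_tensorProduct, hdim₁, hdim₂] at hle
  rw [Nat.add_sub_cancel]
  exact LinearMap.ker_eq_top.mp (top_le_iff.mp hle)
end

section
/- Let n ≥ 1 and let u be a single unipotent Jordan block of size 2n acting on a 2n-dimensional K-vector space V; set α = ν₂(n). Then the smallest Jordan block size of ∧²u on ∧²(V) is 2^α, and it occurs with multiplicity one. -/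
open Module LinearMap

/-- `(E, wedge)` is a model of the exterior square `∧²V` of `V`: `wedge` is an alternating
bilinear map whose image spans `E`, and `E` has the dimension `C(dim V, 2)` of the exterior
square. This characterizes `∧²V` together with its canonical map up to isomorphism. -/
def IsExteriorSquare (K : Type*) [Field K] {V E : Type*} [AddCommGroup V] [Module K V]
    [AddCommGroup E] [Module K E] (wedge : V →ₗ[K] V →ₗ[K] E) : Prop :=
  (∀ v, wedge v v = 0) ∧
  Submodule.span K {x | ∃ v w, wedge v w = x} = ⊤ ∧
  Module.finrank K E = Nat.choose (Module.finrank K V) 2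

theorem aux_pow_two {R : Type*} [Ring R] (h2 : (2 : R) = 0) (a : R) (k : ℕ) :
    (a - 1) ^ (2 ^ k) = a ^ (2 ^ k) - 1 := by
  induction k with
  | zero => simp
  | succ k ih =>
    rw [pow_succ, pow_mul, ih, pow_mul]
    set b := a ^ (2 ^ k)
    have : (b - 1) ^ 2 = b ^ 2 - 1 - 2 * (b - 1) := by noncomm_ring
    rw [this, h2]; simp

theorem aux_pow_geom {R : Type*} [Ring R] (h2 : (2 : R) = 0) (a : R) (k : ℕ) :
    (a - 1) ^ (2 ^ k - 1) = ∑ i ∈ Finset.range (2 ^ k), a ^ i := by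
  induction k with
  | zero => simp
  | succ k ih =>
    have hp : 0 < 2 ^ k := by positivity
    have e : 2 ^ (k + 1) - 1 = 2 ^ k + (2 ^ k - 1) := by omega
    rw [e, pow_add, ih, aux_pow_two h2, pow_succ, mul_two, Finset.sum_range_add]
    have h3 : (-1 : R) = 1 := by
      have : (1 : R) + 1 = 0 := by rw [one_add_one_eq_two, h2]
      exact (eq_neg_of_add_eq_zero_left this).symm
    rw [sub_eq_add_neg, h3, add_mul, one_mul, Finset.mul_sum, add_comm]
    simp [pow_add]

section rk
variable {K : Type*} [Field K] {E : Type*} [AddCommGroup E] [Module K E] [FiniteDimensional K E]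

noncomputable def defect (f : E →ₗ[K] E) (j : ℕ) : ℕ :=
  Module.finrank K (LinearMap.ker f ⊓ LinearMap.range (f ^ j) : Submodule K E)

theorem range_pow_anti (f : E →ₗ[K] E) {i j : ℕ} (h : i ≤ j) :
    LinearMap.range (f ^ j) ≤ LinearMap.range (f ^ i) := by
  obtain ⟨c, rfl⟩ := Nat.exists_eq_add_of_le h
  rw [pow_add]
  exact LinearMap.range_comp_le_range _ _

theorem defect_anti (f : E →ₗ[K] E) {i j : ℕ} (h : i ≤ j) : defect f j ≤ defect f i :=
  Submodule.finrank_mono (inf_le_inf_left _ (range_pow_anti f h))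

theorem rank_succ (f : E →ₗ[K] E) (j : ℕ) :
    Module.finrank K (LinearMap.range (f ^ (j + 1))) + defect f j =
      Module.finrank K (LinearMap.range (f ^ j)) := by
  have h := LinearMap.finrank_range_add_finrank_ker (f.domRestrict (LinearMap.range (f ^ j)))
  rw [← h, LinearMap.range_domRestrict, pow_succ', Module.End.mul_eq_comp,
    LinearMap.range_comp, LinearMap.ker_domRestrict]
  congr 1
  unfold defect
  rw [inf_comm, ← Submodule.map_comap_subtype]
  exact (Submodule.equivMapOfInjective _ (Submodule.injective_subtype _) _).finrank_eq.symm

theorem rank_sum (f : E →ₗ[K] E) (j : ℕ) :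
    Module.finrank K (LinearMap.range (f ^ j)) + ∑ i ∈ Finset.range j, defect f i =
      Module.finrank K E := by
  induction j with
  | zero => 
    have h0 : f ^ 0 = LinearMap.id := pow_zero f
    rw [h0, LinearMap.range_id, finrank_top]
    simp
  | succ j ih =>
    rw [Finset.sum_range_succ]
    have := rank_succ f j
    omega

theorem mult_final (f : E →ₗ[K] E) (n q : ℕ) (hn : 1 ≤ n) (hq : 1 ≤ q)
    (h1 : defect f 0 ≤ n) (h2 : defect f q < defect f 0)
    (h3 : Module.finrank K (LinearMap.range (f ^ (2 * q))) + 2 * q * n ≤ Module.finrank K E + q) :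
    jordanMult K f q = 1 ∧ ∀ d : ℕ, 1 ≤ d → d < q → jordanMult K f d = 0 := by
  have hs := rank_sum f (2 * q)
  have hle : ∀ j, defect f j ≤ n - if q ≤ j then 1 else 0 := by
    intro j
    split_ifs with hj
    · have := defect_anti f hj; omega
    · have := defect_anti f (Nat.zero_le j); omega
  have hsum : ∑ i ∈ Finset.range (2 * q), (n - if q ≤ i then 1 else 0) = q * n + q * (n - 1) := by
    rw [two_mul, Finset.sum_range_add]
    congr 1
    · rw [Finset.sum_congr rfl (g := fun _ => n)]
      · simp
      · intro x hx; have := Finset.mem_range.1 hx; rw [if_neg (by omega)]; rfl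
    · simp
  have hq' : q * (n - 1) + q = q * n := by
    obtain ⟨m, rfl⟩ := Nat.exists_eq_add_of_le hn
    simp; ring
  have heq : ∀ j ∈ Finset.range (2 * q), defect f j = n - if q ≤ j then 1 else 0 := by
    apply (Finset.sum_eq_sum_iff_of_le (fun i _ => hle i)).1
    apply le_antisymm (Finset.sum_le_sum (fun i _ => hle i))
    rw [hsum]
    have : 2 * q * n = q * n + q * n := by ring
    omega
  have hm : ∀ d, 1 ≤ d → d < 2 * q → jordanMult K f d = defect f (d - 1) - defect f d := by
    intro d hd _
    obtain ⟨d, rfl⟩ := Nat.exists_eq_add_of_le hd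
    have a := rank_succ f d
    have b := rank_succ f (d + 1)
    rw [add_comm 1 d]
    unfold jordanMult
    rw [Nat.add_sub_cancel]
    omega
  refine ⟨?_, fun d hd hdq => ?_⟩
  · rw [hm q hq (by omega), heq _ (by simp; omega), heq _ (by simp; omega)]
    split_ifs <;> omega
  · rw [hm d hd (by omega), heq _ (by simp; omega), heq _ (by simp; omega)]
    split_ifs <;> omega
end rk

section cyc
variable {K : Type*} [Field K] {V : Type*} [AddCommGroup V] [Module K V]

theorem cyc_linInd (N : V →ₗ[K] V) (v : V) (m : ℕ) (h0 : N ^ m = 0) (hv : (N ^ (m - 1)) v ≠ 0) :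
    LinearIndependent K (fun j : Fin m => (N ^ (j : ℕ)) v) := by
  rw [Fintype.linearIndependent_iff]
  intro g hg
  by_contra! hne
  obtain ⟨i0, hi0⟩ := hne
  have hex : ∃ j : ℕ, ∃ h : j < m, g ⟨j, h⟩ ≠ 0 := ⟨i0, i0.2, hi0⟩
  classical
  obtain ⟨hj, hgj⟩ := Nat.find_spec hex
  set j := Nat.find hex
  have hmin : ∀ i : Fin m, (i : ℕ) < j → g i = 0 := by
    intro i hi
    by_contra hh
    exact Nat.find_min hex hi ⟨i.2, hh⟩
  have h1 := congrArg (N ^ (m - 1 - j)) hg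
  rw [map_zero, map_sum, Finset.sum_eq_single ⟨j, hj⟩] at h1
  · rw [map_smul, ← Module.End.mul_apply, ← pow_add] at h1
    rw [show m - 1 - j + j = m - 1 by omega] at h1
    exact (smul_ne_zero hgj hv) h1
  · intro b _ hb
    by_cases hlt : (b : ℕ) < j
    · simp [hmin b hlt]
    · have : (b : ℕ) ≠ j := fun h => hb (Fin.ext h)
      rw [map_smul, ← Module.End.mul_apply, ← pow_add]
      rw [show m - 1 - j + b = m + (b - j - 1) by omega, pow_add, h0]
      simp
  · simp

theorem cyc_basis [FiniteDimensional K V] (N : V →ₗ[K] V) (v : V) (m : ℕ)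
    (hm : Module.finrank K V = m) (hm1 : 1 ≤ m)
    (h0 : N ^ m = 0) (hv : (N ^ (m - 1)) v ≠ 0) :
    ∃ b : Module.Basis (Fin m) K V, ∀ j, b j = (N ^ (j : ℕ)) v := by
  have : Nonempty (Fin m) := ⟨⟨0, hm1⟩⟩
  refine ⟨basisOfLinearIndependentOfCardEqFinrank (cyc_linInd N v m h0 hv) (by simp [hm]), ?_⟩
  intro j; simp

theorem free_lemma {W : Type*} [AddCommGroup W] [Module K W]
    (N : V →ₗ[K] V) (v : V) (m r s : ℕ) (hr : 0 < r) (hrs : m = r * s)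
    (h0 : N ^ m = 0) (b : Module.Basis (Fin m) K V) (hb : ∀ j, b j = (N ^ (j : ℕ)) v)
    (G : W →ₗ[K] W) (hG : G ^ s = 0) (hm : 0 < m) (w : ℕ → W) :
    ∃ T : V →ₗ[K] W, (∀ x, T ((N ^ r) x) = G (T x)) ∧ ∀ a < r, T ((N ^ a) v) = w a := by
  let T : V →ₗ[K] W := b.constr K (fun j => (G ^ ((j : ℕ) / r)) (w (j % r)))
  have hT : ∀ j, T ((N ^ j) v) = (G ^ (j / r)) (w (j % r)) := by
    intro j
    by_cases hj : j < m
    · have := b.constr_basis K (fun j : Fin m => (G ^ ((j : ℕ) / r)) (w (j % r))) ⟨j, hj⟩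
      rw [hb] at this
      exact this
    · obtain ⟨c, rfl⟩ := Nat.exists_eq_add_of_le (not_lt.1 hj)
      rw [pow_add, h0, hrs]
      rw [Nat.mul_add_div hr, pow_add, hG]
      simp
  refine ⟨T, ?_, ?_⟩
  · have : T ∘ₗ (N ^ r) = G ∘ₗ T := by
      apply b.ext
      intro j
      rw [LinearMap.comp_apply, LinearMap.comp_apply, hb, ← Module.End.mul_apply, ← pow_add, hT, hT,
        Nat.add_div_left _ hr, Nat.add_mod_left, pow_succ', Module.End.mul_apply]
    intro x
    exact LinearMap.congr_fun this x
  · intro a ha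
    rw [hT, Nat.div_eq_of_lt ha, Nat.mod_eq_of_lt ha]
    simp
end cyc

section alt
variable {K : Type*} [Field K] {V : Type*} [AddCommGroup V] [Module K V]

instance bilSubGroup (S : Submodule K (V →ₗ[K] V →ₗ[K] K)) : AddCommGroup S :=
  @Submodule.addCommGroup K (V →ₗ[K] V →ₗ[K] K) _ LinearMap.addCommGroup LinearMap.module S

def AltS (K V : Type*) [Field K] [AddCommGroup V] [Module K V] :
    Submodule K (V →ₗ[K] V →ₗ[K] K) where
  carrier := {B | ∀ x, B x x = 0}
  add_mem' := by intro a b ha hb x; simp [ha x, hb x]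
  zero_mem' := by intro x; simp
  smul_mem' := by intro c a ha x; simp [ha x]

theorem alt_swap {M : Type*} [AddCommGroup M] [Module K M] (B : V →ₗ[K] V →ₗ[K] M)
    (h : ∀ x, B x x = 0) (x y : V) :
    B x y = - B y x := by
  have := h (x + y)
  simp only [map_add, LinearMap.add_apply, h, zero_add, add_zero] at this
  exact eq_neg_of_add_eq_zero_right this

theorem finrank_alt_le [FiniteDimensional K V] :
    Module.finrank K (AltS K V) ≤ (Module.finrank K V).choose 2 := by
  set m := Module.finrank K V
  let b := Module.finBasis K V
  let L : AltS K V →ₗ[K] ((Σ j : Fin m, Fin (j : ℕ)) → K) :=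
    { toFun := fun B p => B.1 (b ⟨p.2, p.2.2.trans p.1.2⟩) (b p.1)
      map_add' := by intro x y; ext p; simp
      map_smul' := by intro x y; ext p; simp }
  have hL : Function.Injective L := by
    rw [injective_iff_map_eq_zero]
    intro B hB
    have hlt : ∀ i j : Fin m, i < j → B.1 (b i) (b j) = 0 := by
      intro i j hij
      exact congrFun hB ⟨j, ⟨i, hij⟩⟩
    apply Subtype.ext
    apply b.ext
    intro i
    apply b.ext
    intro j
    change B.1 (b i) (b j) = 0
    rcases lt_trichotomy i j with h | h | h
    · exact hlt _ _ h
    · rw [h]; exact B.2 _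
    · rw [alt_swap B.1 B.2, hlt _ _ h, neg_zero]
  have := LinearMap.finrank_le_finrank_of_injective hL
  refine this.trans (le_of_eq ?_)
  rw [Module.finrank_fintype_fun_eq_card, Fintype.card_sigma]
  simp only [Fintype.card_fin]
  rw [Fin.sum_univ_eq_sum_range (fun i => i) m, Finset.sum_range_id, Nat.choose_two_right]

theorem alt_lift [FiniteDimensional K V] {E : Type*} [AddCommGroup E] [Module K E]
    [FiniteDimensional K E] (wedge : V →ₗ[K] V →ₗ[K] E) (hE : IsExteriorSquare K wedge) :
    ∃ e : Module.Dual K E ≃ₗ[K] AltS K V, ∀ φ x y, (e φ).1 x y = φ (wedge x y) := by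
  obtain ⟨h1, h2, h3⟩ := hE
  let L : Module.Dual K E →ₗ[K] AltS K V :=
    { toFun := fun φ => ⟨wedge.compr₂ φ, fun x => by simp [h1]⟩
      map_add' := by intro x y; rfl
      map_smul' := by intro x y; rfl }
  have hL : Function.Injective L := by
    rw [injective_iff_map_eq_zero]
    intro φ hφ
    apply LinearMap.ext_on h2
    rintro _ ⟨x, y, rfl⟩
    exact LinearMap.congr_fun (LinearMap.congr_fun (congrArg Subtype.val hφ) x) y
  have hf : Module.finrank K (Module.Dual K E) = Module.finrank K (AltS K V) := by
    apply le_antisymm (LinearMap.finrank_le_finrank_of_injective hL)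
    rw [Subspace.dual_finrank_eq, h3]
    exact finrank_alt_le
  exact ⟨LinearEquiv.ofInjectiveOfFinrankEq L hL hf, fun φ x y => rfl⟩
end alt
theorem add_self_zero {K : Type*} [Field K] (h2 : (2 : K) = 0) {M : Type*} [AddCommGroup M]
    [Module K M] (x : M) : x + x = 0 := by
  rw [← two_smul K, h2, zero_smul]

theorem neg_self {K : Type*} [Field K] (h2 : (2 : K) = 0) {M : Type*} [AddCommGroup M]
    [Module K M] (x : M) : -x = x :=
  (eq_neg_of_add_eq_zero_left (add_self_zero h2 x)).symm

theorem end_two {K : Type*} [Field K] (h2 : (2 : K) = 0) {M : Type*} [AddCommGroup M]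
    [Module K M] : (2 : M →ₗ[K] M) = 0 := by
  have h : (2 : M →ₗ[K] M) = 1 + 1 := one_add_one_eq_two.symm
  rw [h]
  ext x
  exact add_self_zero h2 x

theorem finrank_split {K : Type*} [Field K] {M M' : Type*} [AddCommGroup M] [Module K M]
    [AddCommGroup M'] [Module K M'] [FiniteDimensional K M] (p : Submodule K M) (g : M →ₗ[K] M') :
    Module.finrank K (p.map g) + Module.finrank K (p ⊓ LinearMap.ker g : Submodule K M) =
      Module.finrank K p := by
  have h := LinearMap.finrank_range_add_finrank_ker (g.domRestrict p)
  rw [← h, LinearMap.range_domRestrict, LinearMap.ker_domRestrict]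
  congr 1
  rw [← Submodule.map_comap_subtype]
  exact (Submodule.equivMapOfInjective _ (Submodule.injective_subtype _) _).finrank_eq.symm

section inv
variable {K : Type*} [Field K] {V : Type*} [AddCommGroup V] [Module K V]

def InvS (h : V →ₗ[K] V) : Submodule K (V →ₗ[K] V →ₗ[K] K) where
  carrier := {B | ∀ x y, B (h x) (h y) = B x y}
  add_mem' := by intro a b ha hb x y; simp [ha x y, hb x y]
  zero_mem' := by intro x; simp
  smul_mem' := by intro c a ha x y; simp [ha x y]

theorem span_N (N : V →ₗ[K] V) (v : V) (m r : ℕ) (hr : 0 < r) 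
    (b : Module.Basis (Fin m) K V) (hb : ∀ j, b j = (N ^ (j : ℕ)) v)
    (S : Submodule K V) (hS : ∀ a < r, (N ^ a) v ∈ S) (hN : ∀ x ∈ S, (N ^ r) x ∈ S) : S = ⊤ := by
  have key : ∀ j, (N ^ j) v ∈ S := by
    intro j
    induction j using Nat.strong_induction_on with
    | _ j ih =>
      by_cases h : j < r
      · exact hS j h
      · have := hN _ (ih (j - r) (by omega))
        rwa [← Module.End.mul_apply, ← pow_add, show r + (j - r) = j by omega] at this
  rw [eq_top_iff, ← b.span_eq, Submodule.span_le]
  rintro _ ⟨j, rfl⟩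
  rw [hb]
  exact key j

theorem inv_alt_lower [FiniteDimensional K V] (h2 : (2 : K) = 0) (U Ui : V →ₗ[K] V)
    (hU : U * Ui = 1) (hU' : Ui * U = 1) (v : V) (m t s : ℕ)
    (hms : m = 2 ^ t * s) (h0 : (U - 1) ^ m = 0) (hm : 0 < m) (hdim : Module.finrank K V = m)
    (b : Module.Basis (Fin m) K V) (hb : ∀ j, b j = ((U - 1) ^ (j : ℕ)) v) :
    2 ^ t * m ≤ 2 * Module.finrank K (AltS K V ⊓ InvS (U ^ (2 ^ t)) : Submodule K (V →ₗ[K] V →ₗ[K] K))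
      + 2 ^ t := by
  have hr : 0 < 2 ^ t := by positivity
  have hNr : (U - 1) ^ (2 ^ t) = U ^ (2 ^ t) - 1 := aux_pow_two (end_two h2) U t
  have hcomm : Commute U Ui := by rw [Commute, SemiconjBy, hU, hU']
  have hh : U ^ (2 ^ t) * Ui ^ (2 ^ t) = 1 := by rw [← hcomm.mul_pow, hU, one_pow]
  have hh' : Ui ^ (2 ^ t) * U ^ (2 ^ t) = 1 := by rw [← hcomm.symm.mul_pow, hU', one_pow]
  set r := 2 ^ t with hrdef
  set h := U ^ r with hhdef
  set hi := Ui ^ r with hhidef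
  have hhx : ∀ x, h (hi x) = x := fun x => LinearMap.congr_fun hh x
  have hhx' : ∀ x, hi (h x) = x := fun x => LinearMap.congr_fun hh' x
  let G : (V →ₗ[K] K) →ₗ[K] (V →ₗ[K] K) := LinearMap.lcomp K K (hi - 1)
  have hGs : G ^ s = 0 := by
    have e1 : ∀ j : ℕ, ∀ w x, (G ^ j) w x = w (((hi - 1) ^ j) x) := by
      intro j
      induction j with
      | zero => intro w x; simp
      | succ j ih =>
        intro w x
        rw [pow_succ, Module.End.mul_apply, ih, pow_succ', Module.End.mul_apply]
        rfl
    have e2 : (hi - 1) = - (hi * (U - 1) ^ r) := by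
      rw [hNr, mul_sub, hh', mul_one, neg_sub]
    have e3 : Commute hi ((U - 1) ^ r) := by
      rw [hNr]
      refine Commute.sub_right ?_ (Commute.one_right _)
      rw [Commute, SemiconjBy, hh, hh']
    have e4 : (hi - 1) ^ s = 0 := by
      rw [e2, neg_pow, e3.mul_pow, ← pow_mul (U - 1), ← hms, h0]; simp
    ext w x
    rw [e1, e4]; simp
  have A1 : r * m ≤ Module.finrank K (InvS h) := by
    let P : (V →ₗ[K] V →ₗ[K] K) →ₗ[K] (Fin r → (V →ₗ[K] K)) :=
      LinearMap.pi (fun a => LinearMap.applyₗ (((U - 1) ^ (a : ℕ)) v))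
    have hP : (InvS h).map P = ⊤ := by
      rw [eq_top_iff]
      intro w _
      obtain ⟨T, hT1, hT2⟩ := free_lemma (U - 1) v m r s hr hms h0 b hb G hGs hm
        (fun a => if ha : a < r then w ⟨a, ha⟩ else 0)
      refine ⟨T, ?_, ?_⟩
      · intro x y
        have := LinearMap.congr_fun (hT1 x) (h y)
        rw [hNr] at this
        simp only [LinearMap.sub_apply, map_sub, Module.End.one_apply, G, LinearMap.lcomp_apply, hhx'] at this
        have := sub_left_injective this
        exact this
      · funext a
        change T (((U - 1) ^ (a : ℕ)) v) = w a
        rw [hT2 a a.2]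
        simp
    have := finrank_split (K := K) (M := V →ₗ[K] V →ₗ[K] K) (M' := Fin r → (V →ₗ[K] K)) (InvS h) P
    rw [hP, finrank_top, Module.finrank_pi_fintype] at this
    simp only [Module.finrank_linearMap, hdim, Module.finrank_self, mul_one, Finset.sum_const, Finset.card_univ,
      Fintype.card_fin, smul_eq_mul] at this
    omega
  let D : (V →ₗ[K] V →ₗ[K] K) →ₗ[K] (V →ₗ[K] V →ₗ[K] K) :=
    LinearMap.id + LinearMap.lflip.toLinearMap
  have hD : ∀ B x y, D B x y = B x y + B y x := fun B x y => rfl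
  have A2 := finrank_split (K := K) (M := V →ₗ[K] V →ₗ[K] K) (M' := V →ₗ[K] V →ₗ[K] K) (InvS h) D
  have A3 : (InvS h).map D ≤ AltS K V ⊓ InvS h := by
    rintro _ ⟨B, hB, rfl⟩
    refine ⟨?_, ?_⟩
    · intro x; rw [hD]; exact add_self_zero h2 _
    · intro x y; rw [hD, hD, hB, hB]
  let Q : (V →ₗ[K] V →ₗ[K] K) →ₗ[K] (Fin r → K) :=
      LinearMap.pi (fun a => LinearMap.applyₗ (((U - 1) ^ (a : ℕ)) v) ∘ₗ LinearMap.applyₗ (((U - 1) ^ (a : ℕ)) v))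
  have A4 := finrank_split (K := K) (M := V →ₗ[K] V →ₗ[K] K) (M' := Fin r → K) (InvS h ⊓ LinearMap.ker D) Q
  have A5 : (InvS h ⊓ LinearMap.ker D) ⊓ LinearMap.ker Q ≤ AltS K V ⊓ InvS h := by
    rintro B ⟨⟨hB, hBD⟩, hBQ⟩
    refine ⟨?_, hB⟩
    have hsym : ∀ x y, B x y + B y x = 0 := by
      intro x y; rw [← hD, LinearMap.mem_ker.1 hBD]; rfl
    let S : Submodule K V :=
      { carrier := {x | B x x = 0}
        add_mem' := by
          intro x y hx hy
          change B (x + y) (x + y) = 0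
          have hx : B x x = 0 := hx
          have hy : B y y = 0 := hy
          have := hsym x y
          simp only [map_add, LinearMap.add_apply, hx, hy, zero_add, add_zero]
          rw [add_comm]; exact this
        zero_mem' := by simp
        smul_mem' := by
          intro c x hx
          have hx : B x x = 0 := hx
          change B (c • x) (c • x) = 0
          simp [hx] }
    have hS : S = ⊤ := by
      apply span_N (U - 1) v m r hr b hb
      · intro a ha
        exact congrFun (LinearMap.mem_ker.1 hBQ) ⟨a, ha⟩
      · intro x hx
        rw [hNr]
        refine S.sub_mem ?_ hx
        exact (hB x x).trans hx
    intro x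
    have : x ∈ S := by rw [hS]; trivial
    exact this
  have A6 : Module.finrank K ((InvS h ⊓ LinearMap.ker D).map Q) ≤ r := by
    refine (Submodule.finrank_le _).trans ?_
    simp
  have A7 := Submodule.finrank_mono A3
  have A8 := Submodule.finrank_mono A5
  omega

theorem coinv_upper {E : Type*} [AddCommGroup E] [Module K E] (wedge : V →ₗ[K] V →ₗ[K] E)
    (hE : IsExteriorSquare K wedge) (U Ui : V →ₗ[K] V) 
    (hU : U * Ui = 1) (v : V) (n : ℕ) 
    (b : Module.Basis (Fin (2 * n)) K V) (hb : ∀ j, b j = ((U - 1) ^ (j : ℕ)) v)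
    (uE : E →ₗ[K] E) (huE : ∀ v w, uE (wedge v w) = wedge (U v) (U w)) :
    Module.finrank K (LinearMap.range (uE - 1)).dualAnnihilator ≤ n := by
  let L : Module.Dual K E →ₗ[K] (Fin n → K) :=
    LinearMap.pi (fun i => LinearMap.applyₗ (wedge v ((U ^ ((i : ℕ) + 1)) v)))
  let L' := L.domRestrict (LinearMap.range (uE - 1)).dualAnnihilator
  have hL : Function.Injective L' := by
    rw [injective_iff_map_eq_zero]
    rintro ⟨φ, hφ⟩ hz
    rw [Submodule.mem_dualAnnihilator] at hφ
    apply Subtype.ext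
    change φ = 0
    have hinv : ∀ x y, φ (wedge (U x) (U y)) = φ (wedge x y) := by
      intro x y
      have := hφ _ ⟨wedge x y, rfl⟩
      rw [LinearMap.sub_apply, huE, map_sub, Module.End.one_apply, sub_eq_zero] at this
      exact this
    have hinvj : ∀ j : ℕ, ∀ x y, φ (wedge ((U ^ j) x) ((U ^ j) y)) = φ (wedge x y) := by
      intro j
      induction j with
      | zero => intro x y; simp
      | succ j ih => intro x y; rw [pow_succ', Module.End.mul_apply, Module.End.mul_apply, hinv, ih]
    have hsmall : ∀ i ≤ n, φ (wedge v ((U ^ i) v)) = 0 := by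
      intro i hi
      rcases i with _ | i
      · simp [hE.1]
      · exact congrFun hz ⟨i, hi⟩
    have hrad0 : ∀ i, i < 2 * n → φ (wedge ((U ^ n) v) ((U ^ i) v)) = 0 := by
      intro i hi
      by_cases h : n ≤ i
      · obtain ⟨c, rfl⟩ := Nat.exists_eq_add_of_le h
        rw [pow_add, Module.End.mul_apply, hinvj]
        exact hsmall c (by omega)
      · obtain ⟨c, hc⟩ := Nat.exists_eq_add_of_le (not_le.1 h).le
        rw [hc, pow_add, Module.End.mul_apply, hinvj, alt_swap wedge hE.1, map_neg,
          hsmall c (by omega), neg_zero]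
    have hrad1 : ∀ j i, i + j < 2 * n → φ (wedge ((U ^ n) v) ((U ^ i) (((U - 1) ^ j) v))) = 0 := by
      intro j
      induction j with
      | zero => intro i hi; simpa using hrad0 i hi
      | succ j ih =>
        intro i hi
        rw [pow_succ', Module.End.mul_apply, LinearMap.sub_apply, map_sub, map_sub, map_sub,
          Module.End.one_apply, ih i (by omega), ← Module.End.mul_apply, ← pow_succ,
          ih (i + 1) (by omega), sub_zero]
    have hrad2 : ∀ y, φ (wedge ((U ^ n) v) y) = 0 := by
      have : φ ∘ₗ wedge ((U ^ n) v) = 0 := by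
        apply b.ext
        intro j
        rw [hb]
        simpa using hrad1 j 0 (by omega)
      intro y
      exact LinearMap.congr_fun this y
    have hrad3 : ∀ y, φ (wedge v y) = 0 := by
      intro y
      rw [← hinvj n]; exact hrad2 _
    have hS : LinearMap.ker (wedge.compr₂ φ) = ⊤ := by
      apply span_N (U - 1) v (2 * n) 1 one_pos b hb
      · intro a ha
        obtain rfl : a = 0 := by omega
        ext y; exact hrad3 y
      · intro x hx
        rw [pow_one]
        refine Submodule.sub_mem _ ?_ hx
        rw [LinearMap.mem_ker]
        ext y
        have e : U (Ui y) = y := LinearMap.congr_fun hU y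
        change φ (wedge (U x) y) = 0
        rw [← e, hinv]
        exact LinearMap.congr_fun (LinearMap.mem_ker.1 hx) (Ui y)
    apply LinearMap.ext_on hE.2.1
    rintro _ ⟨x, y, rfl⟩
    have : x ∈ LinearMap.ker (wedge.compr₂ φ) := by rw [hS]; trivial
    exact LinearMap.congr_fun (LinearMap.mem_ker.1 this) y
  have := LinearMap.finrank_le_finrank_of_injective hL
  simpa using this
end inv
theorem aux_sq {R : Type*} [Ring R] (a : R) : (a - 1) ^ 2 = a * a + 1 - (a + a) := by
  noncomm_ring

theorem fixed_bivector {K : Type*} [Field K] (h2 : (2 : K) = 0) {V E : Type*} [AddCommGroup V]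
    [Module K V] [AddCommGroup E] [Module K E] (wedge : V →ₗ[K] V →ₗ[K] E)
    (hw : ∀ x, wedge x x = 0) (h z : V →ₗ[K] V) (hz : Commute z h) (hh : h * h = z * h + 1)
    (k : ℕ) (hk : z ^ k = 0) (v : V) :
    ∑ i ∈ Finset.range k, wedge (h ((z ^ i) v)) (h ((z ^ (k - 1 - i)) (h v))) =
      ∑ i ∈ Finset.range k, wedge ((z ^ i) v) ((z ^ (k - 1 - i)) (h v)) := by
  have hc : ∀ i x, h ((z ^ i) x) = (z ^ i) (h x) := by
    intro i x
    rw [← Module.End.mul_apply, ← Module.End.mul_apply, (hz.pow_left i).eq]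
  have hhx : ∀ x, h (h x) = z (h x) + x := fun x => LinearMap.congr_fun hh x
  set p : ℕ → V := fun i => (z ^ i) (h v) with hp
  have hpk : p k = 0 := by simp [hp, hk]
  have e1 : ∀ i ∈ Finset.range k, wedge (h ((z ^ i) v)) (h ((z ^ (k - 1 - i)) (h v))) =
      wedge (p i) (p (k - i)) + wedge (p i) ((z ^ (k - 1 - i)) v) := by
    intro i hi
    have hi := Finset.mem_range.1 hi
    rw [hc, hc, hhx, map_add, map_add, ← Module.End.mul_apply (z ^ (k - 1 - i)) z, ← pow_succ,
      show k - 1 - i + 1 = k - i by omega]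
  rw [Finset.sum_congr rfl e1, Finset.sum_add_distrib]
  have e2 : ∑ i ∈ Finset.range k, wedge (p i) (p (k - i)) = 0 := by
    have e3 : ∑ i ∈ Finset.range (k + 1), wedge (p i) (p (k - i)) = 0 := by
      apply Finset.sum_involution (fun i _ => k - i)
      · intro i hi
        have hi := Finset.mem_range.1 hi
        rw [show k - (k - i) = i by omega, alt_swap wedge hw, neg_add_cancel]
      · intro i hi hne heq
        apply hne
        rw [heq, hw]
      · intro i hi; simp
      · intro i hi
        have hi := Finset.mem_range.1 hi
        change k - (k - i) = i
        omega
    rw [Finset.sum_range_succ, hpk] at e3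
    simpa using e3
  rw [e2, zero_add, ← Finset.sum_range_reflect]
  apply Finset.sum_congr rfl
  intro i hi
  have hi := Finset.mem_range.1 hi
  rw [alt_swap wedge hw, neg_self h2, show k - 1 - (k - 1 - i) = i by omega]

theorem block_exists {K : Type*} [Field K] (h2 : (2 : K) = 0) {V E : Type*} [AddCommGroup V]
    [Module K V] [FiniteDimensional K V] [AddCommGroup E] [Module K E] [FiniteDimensional K E]
    (wedge : V →ₗ[K] V →ₗ[K] E)
    (hE : IsExteriorSquare K wedge) (U Ui : V →ₗ[K] V)
    (hU : U * Ui = 1) (hU' : Ui * U = 1) (v : V) (m t k : ℕ) (hk1 : (k : K) = 1)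
    (hmk : m = 2 ^ t * (2 * k)) (h0 : (U - 1) ^ m = 0) (hm : 0 < m)
    (b : Module.Basis (Fin m) K V) (hb : ∀ j, b j = ((U - 1) ^ (j : ℕ)) v)
    (uE : E →ₗ[K] E) (huE : ∀ v w, uE (wedge v w) = wedge (U v) (U w)) :
    ∃ (e : E) (φ : Module.Dual K E), ((uE - 1) ^ (2 ^ t : ℕ) : E →ₗ[K] E) e = 0 ∧
      (∀ x, φ (((uE - 1) ^ (2 ^ t : ℕ) : E →ₗ[K] E) x) = 0) ∧ φ (((uE - 1) ^ (2 ^ t - 1 : ℕ) : E →ₗ[K] E) e) ≠ 0 := by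
  have hk0 : 0 < k := by
    rcases Nat.eq_zero_or_pos k with h | h
    · subst h; simp at hk1
    · exact h
  have hr : 0 < 2 ^ t := by positivity
  have hNr : (U - 1) ^ (2 ^ t) = U ^ (2 ^ t) - 1 := aux_pow_two (end_two h2) U t
  have hXr : (uE - 1) ^ (2 ^ t) = uE ^ (2 ^ t) - 1 := aux_pow_two (end_two h2) uE t
  have hXg := aux_pow_geom (end_two h2) uE t
  have hcomm : Commute U Ui := by rw [Commute, SemiconjBy, hU, hU']
  have hh : U ^ (2 ^ t) * Ui ^ (2 ^ t) = 1 := by rw [← hcomm.mul_pow, hU, one_pow]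
  have hh' : Ui ^ (2 ^ t) * U ^ (2 ^ t) = 1 := by rw [← hcomm.symm.mul_pow, hU', one_pow]
  have huEj : ∀ j : ℕ, ∀ x y, (uE ^ j) (wedge x y) = wedge ((U ^ j) x) ((U ^ j) y) := by
    intro j
    induction j with
    | zero => intro x y; simp
    | succ j ih =>
      intro x y
      rw [pow_succ', Module.End.mul_apply, ih, huE, pow_succ' U, Module.End.mul_apply,
        Module.End.mul_apply]
  rw [hXr, hXg]
  rw [hmk] at h0
  have hcU : Commute U (U ^ (2 ^ t)) := (Commute.refl U).pow_right _
  have hcUi : Commute U (Ui ^ (2 ^ t)) := hcomm.pow_right _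
  set r := 2 ^ t with hrdef
  set h := U ^ r with hhdef
  set hi := Ui ^ r with hhidef
  let z : V →ₗ[K] V := h + hi
  have hzh : Commute z h := by
    refine Commute.add_left (Commute.refl h) ?_
    rw [Commute, SemiconjBy, hh, hh']
  have hUz : Commute U z := hcU.add_right hcUi
  have h11 : ∀ x : V →ₗ[K] V, x + x = 0 := fun x => add_self_zero h2 x
  have hhsq : h * h = z * h + 1 := by
    change h * h = (h + hi) * h + 1
    rw [add_mul, hh', add_assoc, h11, add_zero]
  have hzk : z ^ k = 0 := by
    have e1 : z = hi * (U - 1) ^ (r * 2) := by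
      rw [pow_mul, hNr]
      have : (h - 1) ^ 2 = h * h + 1 - (h + h) := by noncomm_ring
      rw [this, h11, sub_zero, mul_add, ← mul_assoc, hh', one_mul, mul_one]
    have e2 : Commute hi ((U - 1) ^ (r * 2)) := by
      apply Commute.pow_right
      exact hcUi.symm.sub_right (Commute.one_right _)
    rw [e1, e2.mul_pow, ← pow_mul (U - 1), mul_assoc, h0, mul_zero]
  let A := Polynomial K ⧸ Ideal.span {(Polynomial.X : Polynomial K) ^ k}
  let ξ : A := Ideal.Quotient.mk _ Polynomial.X
  have hξk : ξ ^ k = 0 := by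
    change (Ideal.Quotient.mk _ Polynomial.X) ^ k = (0 : A)
    rw [← map_pow, Ideal.Quotient.eq_zero_iff_mem]
    exact Ideal.subset_span rfl
  have hξk1 : ξ ^ (k - 1) ≠ 0 := by
    change (Ideal.Quotient.mk _ Polynomial.X) ^ (k - 1) ≠ (0 : A)
    rw [← map_pow, Ne, Ideal.Quotient.eq_zero_iff_mem, Ideal.mem_span_singleton,
      pow_dvd_pow_iff Polynomial.X_ne_zero Polynomial.not_isUnit_X]
    omega
  obtain ⟨res, hres⟩ := Module.Projective.exists_dual_eq_one K hξk1
  have hA2 : ∀ a : A, a + a = 0 := fun a => add_self_zero h2 a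
  let L : (A × A) →ₗ[K] (A × A) := (LinearMap.mulLeft K ξ).prodMap (LinearMap.mulLeft K ξ)
  let H : (A × A) →ₗ[K] (A × A) := (LinearMap.snd K A A).prod
    ((LinearMap.mulLeft K ξ) ∘ₗ (LinearMap.snd K A A) + LinearMap.fst K A A)
  have hH : ∀ x, H x = (x.2, ξ * x.2 + x.1) := fun x => rfl
  have hLx : ∀ x, L x = (ξ * x.1, ξ * x.2) := fun x => rfl
  have hLj : ∀ (j : ℕ) x, (L ^ j) x = (ξ ^ j * x.1, ξ ^ j * x.2) := by
    intro j
    induction j with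
    | zero => intro x; simp
    | succ j ih =>
      intro x
      rw [pow_succ', Module.End.mul_apply, ih, hLx]
      simp only [pow_succ', mul_assoc]
  have hG2 : (H - 1) ^ 2 = L * H := by
    have e : (H - 1) ^ 2 = H * H + 1 - (H + H) := aux_sq H
    rw [e, add_self_zero h2 H, sub_zero]
    apply LinearMap.ext
    intro x
    rw [LinearMap.add_apply, Module.End.mul_apply, Module.End.mul_apply, Module.End.one_apply]
    simp only [hH, hLx]
    ext
    · change ξ * x.2 + x.1 + x.1 = ξ * x.2
      rw [add_assoc, hA2, add_zero]
    · change ξ * (ξ * x.2 + x.1) + x.2 + x.2 = ξ * (ξ * x.2 + x.1)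
      rw [add_assoc, hA2, add_zero]
  have hLH : Commute L H := by
    apply LinearMap.ext
    intro x
    rw [Module.End.mul_apply, Module.End.mul_apply]
    simp only [hH, hLx]
    ext
    · rfl
    · change ξ * (ξ * x.2 + x.1) = ξ * (ξ * x.2) + ξ * x.1
      ring
  have hG : (H - 1) ^ (2 * k) = 0 := by
    rw [pow_mul, hG2, hLH.mul_pow]
    have : L ^ k = 0 := by
      apply LinearMap.ext
      intro x
      rw [hLj, hξk]; simp
    rw [this, zero_mul]
  obtain ⟨T, hT1, hT2⟩ := free_lemma (U - 1) v m r (2 * k) hr hmk (by rw [hmk]; exact h0) b hb (H - 1) hG hm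
    (fun _ => ((1, 0) : A × A))
  have hTh : ∀ x, T (h x) = H (T x) := by
    intro x
    have := hT1 x
    rw [hNr, LinearMap.sub_apply, LinearMap.sub_apply, map_sub] at this
    exact sub_left_injective this
  have hHinj : ∀ x y, H x = H y → x = y := by
    intro x y hxy
    rw [hH, hH, Prod.mk.injEq] at hxy
    obtain ⟨e1, e2⟩ := hxy
    rw [e1] at e2
    exact Prod.ext (add_left_cancel e2) e1
  have hTz : ∀ x, T (z x) = L (T x) := by
    intro x
    apply hHinj
    have e : h (z x) = h (h x) + x := by
      have : h (hi x) = x := LinearMap.congr_fun hh x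
      change h (h x + hi x) = _
      rw [map_add, this]
    rw [← hTh, e, map_add, hTh, hTh]
    have e2 := LinearMap.congr_fun hLH.eq (T x)
    rw [Module.End.mul_apply, Module.End.mul_apply] at e2
    rw [← e2]
    simp only [hH, hLx]
    ext
    · change ξ * (T x).2 + (T x).1 + (T x).1 = ξ * (T x).2
      rw [add_assoc, hA2, add_zero]
    · change ξ * (ξ * (T x).2 + (T x).1) + (T x).2 + (T x).2 = ξ * (ξ * (T x).2 + (T x).1)
      rw [add_assoc, hA2, add_zero]
  have hTzj : ∀ (j : ℕ) x, T ((z ^ j) x) = (L ^ j) (T x) := by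
    intro j
    induction j with
    | zero => intro x; simp
    | succ j ih =>
      intro x
      rw [pow_succ', Module.End.mul_apply, hTz, ih, pow_succ', Module.End.mul_apply]
  have hTU : ∀ j a : ℕ, a + j < r → T ((U ^ j) (((U - 1) ^ a) v)) = if j = 0 then (1, 0) else 0 := by
    intro j
    induction j with
    | zero => intro a ha; simpa using hT2 a ha
    | succ j ih =>
      intro a ha
      have e : (U ^ (j + 1)) (((U - 1) ^ a) v) =
          (U ^ j) (((U - 1) ^ a) v) + (U ^ j) (((U - 1) ^ (a + 1)) v) := by
        rw [pow_succ (U - 1), pow_succ U, Module.End.mul_apply, ← map_add]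
        congr 1
        rw [← pow_succ, pow_succ', Module.End.mul_apply, LinearMap.sub_apply, Module.End.one_apply]
        abel
      rw [e, map_add, ih a (by omega), ih (a + 1) (by omega), add_self_zero h2]
      simp
  let B : V →ₗ[K] V →ₗ[K] K := LinearMap.mk₂ K
    (fun x y => res ((T x).1 * (T y).2 + (T x).2 * (T y).1))
    (by intro x x' y; rw [← map_add]; congr 1; simp only [map_add, Prod.fst_add, Prod.snd_add]; ring)
    (by intro c x y; rw [← map_smul]; congr 1; simp only [map_smul, Prod.smul_fst, Prod.smul_snd, smul_mul_assoc, smul_add])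
    (by intro x y y'; rw [← map_add]; congr 1; simp only [map_add, Prod.fst_add, Prod.snd_add]; ring)
    (by intro c x y; rw [← map_smul]; congr 1; simp only [map_smul, Prod.smul_fst, Prod.smul_snd, mul_smul_comm, smul_add])
  have hB : ∀ x y, B x y = res ((T x).1 * (T y).2 + (T x).2 * (T y).1) := fun x y => rfl
  have hBalt : B ∈ AltS K V := by
    intro x
    rw [hB, mul_comm (T x).2, hA2, map_zero]
  have hBinv : ∀ x y, B (h x) (h y) = B x y := by
    intro x y
    rw [hB, hB, hTh, hTh]
    simp only [hH]
    congr 1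
    have := hA2 (ξ * (T x).2 * (T y).2)
    linear_combination this
  obtain ⟨eq, heq⟩ := alt_lift wedge hE
  let φ := eq.symm ⟨B, hBalt⟩
  have hφ : ∀ x y, φ (wedge x y) = B x y := by
    intro x y
    rw [← heq]
    simp [φ]
  let e : E := ∑ i ∈ Finset.range k, wedge ((z ^ i) v) ((z ^ (k - 1 - i)) (h v))
  refine ⟨e, φ, ?_, ?_, ?_⟩
  · rw [LinearMap.sub_apply, Module.End.one_apply, sub_eq_zero]
    simp only [e, map_sum, huEj]
    exact fixed_bivector h2 wedge hE.1 h z hzh hhsq k hzk v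
  · have : φ ∘ₗ (uE ^ r - 1) = 0 := by
      apply LinearMap.ext_on hE.2.1
      rintro _ ⟨x, y, rfl⟩
      rw [LinearMap.comp_apply, LinearMap.sub_apply, Module.End.one_apply, huEj, map_sub, hφ, hφ,
        hBinv, sub_self]
      rfl
    intro x
    exact LinearMap.congr_fun this x
  · have hUzj : ∀ (j i : ℕ) x, (U ^ j) ((z ^ i) x) = (z ^ i) ((U ^ j) x) := by
      intro j i x
      rw [← Module.End.mul_apply, ← Module.End.mul_apply, (hUz.pow_pow j i).eq]
    have hUh : ∀ (j : ℕ) x, (U ^ j) (h x) = h ((U ^ j) x) := by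
      intro j x
      rw [← Module.End.mul_apply, ← Module.End.mul_apply, (hcU.pow_left j).eq]
    have hj : ∀ j ∈ Finset.range r, φ ((uE ^ j) e) = if j = 0 then 1 else 0 := by
      intro j hj
      have hTj := hTU j 0 (by simpa using hj)
      rw [pow_zero, Module.End.one_apply] at hTj
      have : ∀ i ∈ Finset.range k, φ ((uE ^ j) (wedge ((z ^ i) v) ((z ^ (k - 1 - i)) (h v)))) =
          if j = 0 then 1 else 0 := by
        intro i hi
        have hi := Finset.mem_range.1 hi
        rw [huEj, hφ, hUzj, hUzj, hUh, hB, hTzj, hTzj, hTh, hTj, hLj, hLj]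
        split_ifs
        · simp only [hH]
          rw [← hres]
          congr 1
          simp only [mul_one, mul_zero, add_zero, zero_add]
          rw [← pow_add]
          congr 1
          omega
        · simp
      simp only [e, map_sum]
      rw [Finset.sum_congr rfl this, Finset.sum_const, Finset.card_range, nsmul_eq_mul, hk1, one_mul]
    rw [LinearMap.sum_apply, map_sum, Finset.sum_congr rfl hj]
    simp [hr.ne']

theorem exterior_square_smallest_block
    (K : Type*) [Field K] [IsAlgClosed K] [CharP K 2]
    (V : Type*) [AddCommGroup V] [Module K V] [FiniteDimensional K V]
    (n : ℕ) (hn : 1 ≤ n)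
    (u : V ≃ₗ[K] V)
    (hdim : Module.finrank K V = 2 * n)
    (hb : ((u : V →ₗ[K] V) - 1) ^ (2 * n - 1) ≠ 0)
    (hb' : ((u : V →ₗ[K] V) - 1) ^ (2 * n) = 0)
    (E : Type*) [AddCommGroup E] [Module K E]
    (wedge : V →ₗ[K] V →ₗ[K] E) (hE : IsExteriorSquare K wedge)
    (uE : E →ₗ[K] E) (huE : ∀ v w, uE (wedge v w) = wedge (u v) (u w)) :
    jordanMult K (uE - 1) (2 ^ padicValNat 2 n) = 1 ∧
    ∀ d : ℕ, 1 ≤ d → d < 2 ^ padicValNat 2 n → jordanMult K (uE - 1) d = 0 := by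
  have h2 : (2 : K) = 0 := CharTwo.two_eq_zero
  have hEpos : 0 < Module.finrank K E := by
    rw [hE.2.2, hdim]; exact Nat.choose_pos (by omega)
  have hfE : FiniteDimensional K E := Module.finite_of_finrank_pos hEpos
  obtain ⟨v, hv⟩ : ∃ v, (((u : V →ₗ[K] V) - 1) ^ (2 * n - 1)) v ≠ 0 := by
    by_contra! hcon
    exact hb (LinearMap.ext hcon)
  obtain ⟨b, hbas⟩ := cyc_basis ((u : V →ₗ[K] V) - 1) v (2 * n) hdim (by omega) hb' hv
  set U : V →ₗ[K] V := (u : V →ₗ[K] V) with hUdef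
  set Ui : V →ₗ[K] V := (u.symm : V →ₗ[K] V)
  have hU : U * Ui = 1 := by ext x; exact u.apply_symm_apply x
  have hU' : Ui * U = 1 := by ext x; exact u.symm_apply_apply x
  obtain ⟨t, k, hodd, hnk⟩ := Nat.exists_eq_two_pow_mul_odd (n := n) (by omega)
  have ht : padicValNat 2 n = t := by
    rw [hnk, padicValNat.mul (by positivity) hodd.pos.ne', padicValNat.prime_pow,
      padicValNat.eq_zero_of_not_dvd (by rw [← even_iff_two_dvd]; exact Nat.not_even_iff_odd.2 hodd)]
    simp
  have hk1 : (k : K) = 1 := by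
    obtain ⟨c, rfl⟩ := hodd
    push_cast
    rw [h2]; simp
  rw [ht]
  have hq : 0 < 2 ^ t := by positivity
  have hd0 : defect (uE - 1) 0 ≤ n := by
    have h1 := coinv_upper wedge hE U Ui hU v n b hbas uE huE
    have h3 := Subspace.finrank_add_finrank_dualAnnihilator_eq (LinearMap.range (uE - 1))
    have h4 := rank_sum (uE - 1) 1
    rw [pow_one, Finset.sum_range_one] at h4
    omega
  apply mult_final (uE - 1) n (2 ^ t) hn hq hd0
  · obtain ⟨e, φ, he, hφ, hne⟩ := block_exists h2 wedge hE U Ui hU hU' v (2 * n) t k hk1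
      (by rw [hnk]; ring) hb' (by omega) b hbas uE huE
    apply Submodule.finrank_lt_finrank_of_lt
    refine lt_of_le_of_ne (inf_le_inf_left _ (range_pow_anti _ (Nat.zero_le _))) ?_
    intro heq
    have hmem : ((uE - 1) ^ (2 ^ t - 1 : ℕ) : E →ₗ[K] E) e ∈
        (LinearMap.ker (uE - 1) ⊓ LinearMap.range ((uE - 1) ^ 0) : Submodule K E) := by
      refine ⟨?_, ⟨_, rfl⟩⟩
      rw [SetLike.mem_coe, LinearMap.mem_ker, ← Module.End.mul_apply, ← pow_succ',
        show 2 ^ t - 1 + 1 = 2 ^ t by omega]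
      exact he
    rw [← heq] at hmem
    obtain ⟨-, y, hy⟩ := hmem
    apply hne
    rw [← hy]
    exact hφ y
  · have h1 := inv_alt_lower h2 U Ui hU hU' v (2 * n) (t + 1) k (by rw [hnk]; ring) hb' (by omega)
      hdim b hbas
    have h3 := Subspace.finrank_add_finrank_dualAnnihilator_eq
      (LinearMap.range ((uE - 1) ^ (2 * 2 ^ t)))
    obtain ⟨eq, heq⟩ := alt_lift wedge hE
    have huEj : ∀ j : ℕ, ∀ x y, (uE ^ j) (wedge x y) = wedge ((U ^ j) x) ((U ^ j) y) := by
      intro j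
      induction j with
      | zero => intro x y; simp
      | succ j ih =>
        intro x y
        rw [pow_succ', Module.End.mul_apply, ih, huE, pow_succ' U, Module.End.mul_apply,
          Module.End.mul_apply]
        rfl
    let F : Module.Dual K E →ₗ[K] (V →ₗ[K] V →ₗ[K] K) := (AltS K V).subtype ∘ₗ eq.toLinearMap
    have hle : (AltS K V ⊓ InvS (U ^ (2 ^ (t + 1))) : Submodule K (V →ₗ[K] V →ₗ[K] K)) ≤
        (LinearMap.range ((uE - 1) ^ (2 * 2 ^ t))).dualAnnihilator.map F := by
      rintro B ⟨hB1, hB2⟩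
      refine ⟨eq.symm ⟨B, hB1⟩, ?_, by simp [F]⟩
      have hφ : ∀ x y, (eq.symm ⟨B, hB1⟩) (wedge x y) = B x y := by
        intro x y
        rw [← heq]
        simp
      set φ := eq.symm ⟨B, hB1⟩
      rw [← pow_succ', aux_pow_two (end_two h2)]
      have : φ ∘ₗ (uE ^ (2 ^ (t + 1)) - 1) = 0 := by
        apply LinearMap.ext_on hE.2.1
        rintro _ ⟨x, y, rfl⟩
        rw [LinearMap.comp_apply, LinearMap.sub_apply, Module.End.one_apply, huEj, map_sub, hφ, hφ,
          hB2, sub_self]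
        rfl
      rw [SetLike.mem_coe, Submodule.mem_dualAnnihilator]
      rintro _ ⟨x, rfl⟩
      exact LinearMap.congr_fun this x
    have h4 := (Submodule.finrank_mono hle).trans (Submodule.finrank_map_le _ _)
    have h5 : 2 ^ (t + 1) * (2 * n) = 2 * (2 * 2 ^ t * n) := by ring
    have h6 : 2 ^ (t + 1) = 2 * 2 ^ t := by ring
    rw [h5, h6] at h1
    rw [h6] at h4
    omega
end
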